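/- There exist γ > 0 and K₀ > 0 such that for every integer K > K₀ and every ε > 0 there is N₀ = N₀(K, ε) with the following property: for every integer N > N₀, among the finitely many 1-avoiding subsets of 𝕋_K² that are locally constant at scale 1/N, the proportion of sets A satisfying s(1.96; A) ≥ 1 + γ is at least 1 − ε. -/

import Mathlib

open MeasureTheory Filter
open scoped ENNReal

noncomputable section

/-- The Haar measure on the `K × K` torus `𝕋_K² = ℝ²/(Kℤ²)` (total mass `K²`). -/
def torusVolume (K : ℝ) : Measure (AddCircle K × AddCircle K) :=
  if hK : 0 < K then
    haveI : Fact (0 < K) := ⟨hK⟩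
    (volume : Measure (AddCircle K × AddCircle K))
  else 0

/-- Normalized density of a subset of the torus `𝕋_K²`. -/
def density (K : ℝ) (A : Set (AddCircle K × AddCircle K)) : ℝ :=
  (torusVolume K A).toReal / K ^ 2

/-- Autocorrelation function `f(x; A) = δ(A ∩ (A - x))`. -/
def autocorr (K : ℝ) (A : Set (AddCircle K × AddCircle K))
    (x : AddCircle K × AddCircle K) : ℝ :=
  density K (A ∩ (fun y => y + x) ⁻¹' A)

/-- Radialized pair correlation function `f°(r; A)`. -/
def paircorr (K : ℝ) (A : Set (AddCircle K × AddCircle K)) (r : ℝ) : ℝ :=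
  (1 / (2 * Real.pi)) * ∫ θ in (0:ℝ)..(2 * Real.pi),
    autocorr K A (((r * Real.cos θ : ℝ) : AddCircle K), ((r * Real.sin θ : ℝ) : AddCircle K))

/-- Normalized pair correlation `s(r; A) = f°(r; A) / δ(A)²`. -/
def scorr (K : ℝ) (A : Set (AddCircle K × AddCircle K)) (r : ℝ) : ℝ :=
  paircorr K A r / density K A ^ 2

/-- The closed grid square `[j/N,(j+1)/N] × [k/N,(k+1)/N]`, viewed inside the torus `𝕋_K²`. -/
def gridSquare (K N : ℕ) (v : Fin (N * K) × Fin (N * K)) :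
    Set (AddCircle (K : ℝ) × AddCircle (K : ℝ)) :=
  {q | ∃ p : ℝ × ℝ, q = ((p.1 : AddCircle (K : ℝ)), (p.2 : AddCircle (K : ℝ))) ∧
        (v.1 : ℝ) / N ≤ p.1 ∧ p.1 ≤ ((v.1 : ℝ) + 1) / N ∧
        (v.2 : ℝ) / N ≤ p.2 ∧ p.2 ≤ ((v.2 : ℝ) + 1) / N}

/-- A subset of `𝕋_K²` is locally constant at scale `1/N` if it is a union of grid squares. -/
def LocallyConst (K N : ℕ) (A : Set (AddCircle (K : ℝ) × AddCircle (K : ℝ))) : Prop :=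
  ∃ S : Set (Fin (N * K) × Fin (N * K)), A = ⋃ v ∈ S, gridSquare K N v

end

noncomputable section

/-- The Bessel function of order zero, as an angular average. -/
def besselZero (x : ℝ) : ℝ :=
  (1 / (2 * Real.pi)) * ∫ θ in (0:ℝ)..(2 * Real.pi), Real.cos (x * Real.sin θ)

/-- The first derivative of `besselZero`. -/
def besselZeroDeriv (x : ℝ) : ℝ :=
  (1 / (2 * Real.pi)) * ∫ θ in (0:ℝ)..(2 * Real.pi), -(Real.sin θ * Real.sin (x * Real.sin θ))

/-- The second derivative of `besselZero`. -/
def besselZeroDerivTwo (x : ℝ) : ℝ :=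
  (1 / (2 * Real.pi)) * ∫ θ in (0:ℝ)..(2 * Real.pi),
    -(Real.sin θ ^ 2 * Real.cos (x * Real.sin θ))

theorem hasDerivAt_besselZero (x : ℝ) : HasDerivAt besselZero (besselZeroDeriv x) x := by
  refine HasDerivAt.const_mul _ ?_
  refine (intervalIntegral.hasDerivAt_integral_of_dominated_loc_of_deriv_le
    (F := fun x θ => Real.cos (x * Real.sin θ))
    (F' := fun x θ => -(Real.sin θ * Real.sin (x * Real.sin θ)))
    (bound := fun _ => 1) (s := Set.univ) Filter.univ_mem ?_ ?_ ?_ ?_ ?_ ?_).2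
  · exact Eventually.of_forall fun y => by
      apply Continuous.aestronglyMeasurable; fun_prop
  · apply Continuous.intervalIntegrable; fun_prop
  · apply Continuous.aestronglyMeasurable; fun_prop
  · refine ae_of_all _ fun θ _ y _ => ?_
    rw [norm_neg, norm_mul, Real.norm_eq_abs, Real.norm_eq_abs]
    exact mul_le_one₀ (Real.abs_sin_le_one _) (abs_nonneg _) (Real.abs_sin_le_one _)
  · exact intervalIntegrable_const
  · refine ae_of_all _ fun θ _ y _ => ?_
    have := ((hasDerivAt_id y).mul_const (Real.sin θ)).cos
    exact this.congr_deriv (by simp only [id]; ring)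

theorem hasDerivAt_besselZeroDeriv (x : ℝ) :
    HasDerivAt besselZeroDeriv (besselZeroDerivTwo x) x := by
  refine HasDerivAt.const_mul _ ?_
  refine (intervalIntegral.hasDerivAt_integral_of_dominated_loc_of_deriv_le
    (F := fun x θ => -(Real.sin θ * Real.sin (x * Real.sin θ)))
    (F' := fun x θ => -(Real.sin θ ^ 2 * Real.cos (x * Real.sin θ)))
    (bound := fun _ => 1) (s := Set.univ) Filter.univ_mem ?_ ?_ ?_ ?_ ?_ ?_).2
  · exact Eventually.of_forall fun y => by
      apply Continuous.aestronglyMeasurable; fun_prop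
  · apply Continuous.intervalIntegrable; fun_prop
  · apply Continuous.aestronglyMeasurable; fun_prop
  · refine ae_of_all _ fun θ _ y _ => ?_
    rw [norm_neg, norm_mul, Real.norm_eq_abs, Real.norm_eq_abs, abs_pow]
    exact mul_le_one₀ (pow_le_one₀ (abs_nonneg _) (Real.abs_sin_le_one _)) (abs_nonneg _)
      (Real.abs_cos_le_one _)
  · exact intervalIntegrable_const
  · refine ae_of_all _ fun θ _ y _ => ?_
    have := (((hasDerivAt_id y).mul_const (Real.sin θ)).sin.const_mul (Real.sin θ)).neg
    exact this.congr_deriv (by simp only [id]; ring)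

theorem continuous_besselZero : Continuous besselZero :=
  continuous_iff_continuousAt.2 fun x => (hasDerivAt_besselZero x).continuousAt

theorem bessel_equation (x : ℝ) :
    x * besselZeroDerivTwo x + besselZeroDeriv x + x * besselZero x = 0 := by
  have h : ∫ θ in (0:ℝ)..(2 * Real.pi),
      (x * Real.cos θ ^ 2 * Real.cos (x * Real.sin θ) - Real.sin θ * Real.sin (x * Real.sin θ))
      = 0 := by
    rw [intervalIntegral.integral_eq_sub_of_hasDerivAt
      (f := fun θ => Real.cos θ * Real.sin (x * Real.sin θ))]
    · simp
    · intro θ _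
      have := (Real.hasDerivAt_cos θ).mul ((Real.hasDerivAt_sin θ).const_mul x).sin
      exact this.congr_deriv (by ring)
    · apply Continuous.intervalIntegrable; fun_prop
  have e : x * besselZeroDerivTwo x + besselZeroDeriv x + x * besselZero x
      = (1 / (2 * Real.pi)) * ∫ θ in (0:ℝ)..(2 * Real.pi),
      (x * Real.cos θ ^ 2 * Real.cos (x * Real.sin θ)
        - Real.sin θ * Real.sin (x * Real.sin θ)) := by
    unfold besselZero besselZeroDeriv besselZeroDerivTwo
    rw [mul_left_comm, mul_left_comm x, ← mul_add, ← mul_add,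
      ← intervalIntegral.integral_const_mul, ← intervalIntegral.integral_const_mul,
      ← intervalIntegral.integral_add, ← intervalIntegral.integral_add]
    · congr 1
      refine intervalIntegral.integral_congr fun θ _ => ?_
      simp only [Real.cos_sq']
      ring
    all_goals apply Continuous.intervalIntegrable; fun_prop
  rw [e, h, mul_zero]

theorem abs_besselZeroDerivTwo_le (x : ℝ) : |besselZeroDerivTwo x| ≤ 1 / 2 := by
  have hp := Real.pi_pos
  have h : ‖∫ θ in (0:ℝ)..(2 * Real.pi), -(Real.sin θ ^ 2 * Real.cos (x * Real.sin θ))‖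
      ≤ ∫ θ in (0:ℝ)..(2 * Real.pi), Real.sin θ ^ 2 := by
    refine intervalIntegral.norm_integral_le_of_norm_le (by positivity) ?_ ?_
    · refine ae_of_all _ fun θ _ => ?_
      rw [norm_neg, norm_mul, Real.norm_eq_abs, Real.norm_eq_abs, abs_pow, sq_abs]
      exact mul_le_of_le_one_right (sq_nonneg _) (Real.abs_cos_le_one _)
    · apply Continuous.intervalIntegrable; fun_prop
  rw [integral_sin_sq] at h
  simp only [Real.sin_zero, Real.sin_two_pi, Real.norm_eq_abs] at h
  unfold besselZeroDerivTwo
  rw [abs_mul, abs_of_pos (by positivity)]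
  calc _ ≤ 1 / (2 * Real.pi) * Real.pi := by gcongr; linarith
    _ = 1 / 2 := by field_simp

theorem abs_besselZeroDeriv_le (x : ℝ) : |besselZeroDeriv x| ≤ 1 := by
  have hp := Real.pi_pos
  have h : ‖∫ θ in (0:ℝ)..(2 * Real.pi), -(Real.sin θ * Real.sin (x * Real.sin θ))‖
      ≤ 1 * |2 * Real.pi - 0| := by
    refine intervalIntegral.norm_integral_le_of_norm_le_const fun θ _ => ?_
    rw [norm_neg, norm_mul, Real.norm_eq_abs, Real.norm_eq_abs]
    exact mul_le_one₀ (Real.abs_sin_le_one _) (abs_nonneg _) (Real.abs_sin_le_one _)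
  rw [sub_zero, abs_of_pos (by positivity : 0 < 2 * Real.pi), one_mul] at h
  unfold besselZeroDeriv
  rw [abs_mul, abs_of_pos (by positivity)]
  calc _ ≤ 1 / (2 * Real.pi) * (2 * Real.pi) := by gcongr; exact h
    _ = 1 := by field_simp

theorem abs_besselZero_sub_le (x y : ℝ) : |besselZero x - besselZero y| ≤ |x - y| := by
  have := Convex.norm_image_sub_le_of_norm_hasDerivWithin_le (f := besselZero)
    (f' := besselZeroDeriv) (s := Set.univ) (C := 1) (x := y) (y := x)
    (fun z _ => (hasDerivAt_besselZero z).hasDerivWithinAt)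
    (fun z _ => abs_besselZeroDeriv_le z) convex_univ trivial trivial
  simpa using this

theorem besselZero_zero : besselZero 0 = 1 := by
  have hp := Real.pi_pos
  simp only [besselZero, zero_mul, Real.cos_zero, intervalIntegral.integral_const, sub_zero,
    smul_eq_mul, mul_one]
  field_simp

theorem abs_besselZero_le_one (x : ℝ) : |besselZero x| ≤ 1 := by
  have hp := Real.pi_pos
  have h : ‖∫ θ in (0:ℝ)..(2 * Real.pi), Real.cos (x * Real.sin θ)‖
      ≤ 1 * |2 * Real.pi - 0| :=
    intervalIntegral.norm_integral_le_of_norm_le_const fun θ _ => Real.abs_cos_le_one _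
  rw [sub_zero, abs_of_pos (by positivity : 0 < 2 * Real.pi), one_mul] at h
  unfold besselZero
  rw [abs_mul, abs_of_pos (by positivity)]
  calc _ ≤ 1 / (2 * Real.pi) * (2 * Real.pi) := by gcongr; exact h
    _ = 1 := by field_simp

/-- The angular average of a plane wave only depends on the length of the wave vector. -/
theorem average_cos_eq_besselZero (a b : ℝ) :
    (1 / (2 * Real.pi)) * ∫ θ in (0:ℝ)..(2 * Real.pi),
      Real.cos (a * Real.cos θ + b * Real.sin θ) = besselZero (Real.sqrt (a ^ 2 + b ^ 2)) := by
  obtain ⟨φ, ha, hb⟩ : ∃ φ, a = Real.sqrt (a ^ 2 + b ^ 2) * Real.sin φ ∧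
      b = Real.sqrt (a ^ 2 + b ^ 2) * Real.cos φ := by
    have hz : ‖(⟨b, a⟩ : ℂ)‖ = Real.sqrt (a ^ 2 + b ^ 2) := by
      rw [Complex.norm_eq_sqrt_sq_add_sq, add_comm]
    refine ⟨Complex.arg ⟨b, a⟩, ?_, ?_⟩
    · rw [← hz, Complex.norm_mul_sin_arg]
    · rw [← hz, Complex.norm_mul_cos_arg]
  set ρ := Real.sqrt (a ^ 2 + b ^ 2)
  unfold besselZero
  congr 1
  have e : ∀ θ, Real.cos (a * Real.cos θ + b * Real.sin θ)
      = (fun t => Real.cos (ρ * Real.sin t)) (θ + φ) := fun θ => by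
    simp only [Real.sin_add]; rw [ha, hb]; ring_nf
  have hper : Function.Periodic (fun t => Real.cos (ρ * Real.sin t)) (2 * Real.pi) := fun t => by
    simp
  simp only [e]
  rw [intervalIntegral.integral_comp_add_right (fun t => Real.cos (ρ * Real.sin t))]
  have := hper.intervalIntegral_add_eq φ 0
  rw [zero_add] at this
  rw [zero_add, add_comm (2 * Real.pi) φ, this]
end

/-- Decay of the Bessel function, from the monotonicity of an energy functional. -/
theorem mul_besselZero_sq_le {x₀ x : ℝ} (h₀ : 0 < x₀) (hx : x₀ ≤ x) :
    x * besselZero x ^ 2 ≤ x₀ * besselZeroDeriv x₀ ^ 2 + besselZero x₀ * besselZeroDeriv x₀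
      + besselZero x₀ ^ 2 / (2 * x₀) + x₀ * besselZero x₀ ^ 2 := by
  set G : ℝ → ℝ := fun x => x * besselZeroDeriv x ^ 2 + besselZero x * besselZeroDeriv x
      + besselZero x ^ 2 / (2 * x) + x * besselZero x ^ 2 with hG
  have hd : ∀ y, 0 < y → HasDerivAt G (-(besselZero y ^ 2 / (2 * y ^ 2))) y := by
    intro y hy
    have h0 := hasDerivAt_besselZero y
    have h1 := hasDerivAt_besselZeroDeriv y
    have hi := hasDerivAt_id y
    have h2 := (((hi.mul (h1.pow 2)).add (h0.mul h1)).add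
      ((h0.pow 2).div (hi.const_mul 2) (by simp; exact hy.ne'))).add (hi.mul (h0.pow 2))
    refine HasDerivAt.congr_deriv (f := G) h2 ?_
    have hode := bessel_equation y
    have hJ2 : besselZeroDerivTwo y = -(besselZeroDeriv y + y * besselZero y) / y := by
      field_simp; linarith
    simp only [id, Pi.pow_apply, hJ2]
    field_simp
    ring
  have hanti : AntitoneOn G (Set.Ici x₀) := by
    refine antitoneOn_of_deriv_nonpos (convex_Ici _) ?_ ?_ ?_
    · exact fun y hy => (hd y (h₀.trans_le hy)).continuousAt.continuousWithinAt
    · rw [interior_Ici]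
      exact fun y hy => (hd y (h₀.trans hy)).differentiableAt.differentiableWithinAt
    · rw [interior_Ici]
      intro y hy
      rw [(hd y (h₀.trans hy)).deriv, neg_nonpos]
      positivity
  have h1 : G x ≤ G x₀ := hanti Set.self_mem_Ici hx hx
  have hxp : 0 < x := h₀.trans_le hx
  have h2 : x * besselZero x ^ 2 ≤ G x := by
    have : G x - x * besselZero x ^ 2 = x * (besselZeroDeriv x + besselZero x / (2 * x)) ^ 2
        + besselZero x ^ 2 / (4 * x) := by
      simp only [hG]; field_simp; ring
    have h3 : 0 ≤ G x - x * besselZero x ^ 2 := by rw [this]; positivity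
    linarith
  exact h2.trans h1

theorem hasSum_besselZero (x : ℝ) :
    HasSum (fun k : ℕ => (-(x ^ 2 / 4)) ^ k / (k.factorial : ℝ) ^ 2) (besselZero x) := by
  have key : HasSum (fun k : ℕ => ∫ θ in (0:ℝ)..(2 * Real.pi),
      (-1) ^ k * (x * Real.sin θ) ^ (2 * k) / ((2 * k).factorial : ℝ))
      (∫ θ in (0:ℝ)..(2 * Real.pi), Real.cos (x * Real.sin θ)) := by
    have hs : Summable fun k : ℕ => |x| ^ (2 * k) / ((2 * k).factorial : ℝ) :=
      (Real.summable_pow_div_factorial |x|).comp_injective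
        (i := fun k : ℕ => 2 * k) (mul_right_injective₀ two_ne_zero)
    refine intervalIntegral.hasSum_integral_of_dominated_convergence
      (fun k _ => |x| ^ (2 * k) / ((2 * k).factorial : ℝ)) ?_ ?_ ?_ ?_ ?_
    · intro k; apply Continuous.aestronglyMeasurable; fun_prop
    · intro k
      refine ae_of_all _ fun θ _ => ?_
      rw [norm_div, norm_mul, norm_pow, norm_neg, norm_one, one_pow, one_mul, norm_pow,
        Real.norm_natCast, Real.norm_eq_abs, abs_mul]
      gcongr
      exact mul_le_of_le_one_right (abs_nonneg _) (Real.abs_sin_le_one _)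
    · exact ae_of_all _ fun θ _ => hs
    · exact intervalIntegrable_const
    · exact ae_of_all _ fun θ _ => Real.hasSum_cos _
  have hsin : ∀ k : ℕ, ∫ θ in (0:ℝ)..(2 * Real.pi), Real.sin θ ^ (2 * k)
      = 2 * (Real.pi * ∏ i ∈ Finset.range k, (2 * (i : ℝ) + 1) / (2 * i + 2)) := by
    intro k
    have hper : Function.Periodic (fun θ => Real.sin θ ^ (2 * k)) Real.pi := fun θ => by
      simp [Real.sin_add_pi, pow_mul]
    rw [← intervalIntegral.integral_add_adjacent_intervals (b := Real.pi)]
    · have := hper.intervalIntegral_add_eq Real.pi 0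
      rw [zero_add, ← two_mul] at this
      rw [this, integral_sin_pow_even, two_mul]
    all_goals apply Continuous.intervalIntegrable; fun_prop
  have hfac : ∀ k : ℕ, (∏ i ∈ Finset.range k, (2 * (i : ℝ) + 1) / (2 * i + 2)) / ((2 * k).factorial : ℝ)
      = (1 / 4) ^ k / (k.factorial : ℝ) ^ 2 := by
    intro k
    induction k with
    | zero => simp
    | succ k ih =>
      rw [Finset.prod_range_succ, mul_add, mul_one, Nat.factorial_succ, Nat.factorial_succ,
        Nat.factorial_succ]
      push_cast
      have h4 : ((2 * k).factorial : ℝ) ≠ 0 := by positivity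
      have h5 : (k.factorial : ℝ) ≠ 0 := by positivity
      have h6 : (k : ℝ) + 1 ≠ 0 := by positivity
      have h7 : 2 * (k : ℝ) + 1 ≠ 0 := by positivity
      rw [div_eq_iff h4] at ih
      rw [ih]
      field_simp
      ring
  have := key.mul_left (1 / (2 * Real.pi))
  refine HasSum.congr_fun (g := fun k : ℕ => (-(x ^ 2 / 4)) ^ k / (k.factorial : ℝ) ^ 2) this fun k => ?_
  have e : ∀ θ, (-1) ^ k * (x * Real.sin θ) ^ (2 * k) / ((2 * k).factorial : ℝ)
      = ((-1) ^ k * x ^ (2 * k) / ((2 * k).factorial : ℝ)) * Real.sin θ ^ (2 * k) := fun θ => by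
    rw [mul_pow]; ring
  simp only [e]
  rw [intervalIntegral.integral_const_mul, hsin]
  have hp := Real.pi_ne_zero
  calc (-(x ^ 2 / 4)) ^ k / (k.factorial : ℝ) ^ 2
      = (-1) ^ k * x ^ (2 * k) * ((1 / 4) ^ k / (k.factorial : ℝ) ^ 2) := by
        rw [neg_eq_neg_one_mul, mul_pow, div_pow, pow_mul, one_div, inv_pow]; ring
    _ = _ := by rw [← hfac]; field_simp

/-- Truncation of the power series of the Bessel function. -/
theorem abs_besselZero_sub_sum_le {x : ℝ} {n : ℕ} (hn : x ^ 2 / 2 ≤ (n : ℝ) ^ 2) :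
    |besselZero x - ∑ k ∈ Finset.range (n + 1), (-(x ^ 2 / 4)) ^ k / (k.factorial : ℝ) ^ 2|
      ≤ (x ^ 2 / 4) ^ n / (n.factorial : ℝ) ^ 2 := by
  set y := x ^ 2 / 4 with hy
  have hy0 : 0 ≤ y := by positivity
  have hs := (hasSum_nat_add_iff' (n + 1)).2 (hasSum_besselZero x)
  have hb : ∀ j : ℕ, ‖(-y) ^ (j + (n + 1)) / ((j + (n + 1)).factorial : ℝ) ^ 2‖
      ≤ y ^ n / (n.factorial : ℝ) ^ 2 / 2 / 2 ^ j := by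
    intro j
    rw [norm_div, norm_pow, norm_neg, Real.norm_of_nonneg hy0, norm_pow, Real.norm_natCast]
    induction j with
    | zero =>
      rw [zero_add, Nat.factorial_succ, pow_zero, div_one]
      push_cast
      have h1 : y / ((n : ℝ) + 1) ^ 2 ≤ 1 / 2 := by
        rw [div_le_div_iff₀ (by positivity) (by norm_num)]; nlinarith [(n.cast_nonneg : (0:ℝ) ≤ n)]
      calc y ^ (n + 1) / (((n : ℝ) + 1) * n.factorial) ^ 2
          = y ^ n / (n.factorial : ℝ) ^ 2 * (y / ((n : ℝ) + 1) ^ 2) := by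
            rw [pow_succ]; field_simp
        _ ≤ y ^ n / (n.factorial : ℝ) ^ 2 * (1 / 2) := by gcongr
        _ = _ := by ring
    | succ j ih =>
      rw [show j + 1 + (n + 1) = (j + (n + 1)) + 1 by ring, Nat.factorial_succ]
      push_cast
      have h1 : y / ((j : ℝ) + (n + 1) + 1) ^ 2 ≤ 1 / 2 := by
        rw [div_le_div_iff₀ (by positivity) (by norm_num)]
        nlinarith [(n.cast_nonneg : (0:ℝ) ≤ n), (j.cast_nonneg : (0:ℝ) ≤ j),
          mul_nonneg (n.cast_nonneg : (0:ℝ) ≤ n) (j.cast_nonneg : (0:ℝ) ≤ j)]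
      calc y ^ (j + (n + 1) + 1) / (((j : ℝ) + (n + 1) + 1) * (j + (n + 1)).factorial) ^ 2
          = y ^ (j + (n + 1)) / ((j + (n + 1)).factorial : ℝ) ^ 2
            * (y / ((j : ℝ) + (n + 1) + 1) ^ 2) := by
            rw [pow_succ]; field_simp
        _ ≤ y ^ n / (n.factorial : ℝ) ^ 2 / 2 / 2 ^ j * (1 / 2) := by gcongr
        _ = _ := by rw [pow_succ]; field_simp; ring
  have hg := hasSum_geometric_two' (y ^ n / (n.factorial : ℝ) ^ 2)
  have := hs.norm_le_of_bounded hg hb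
  rwa [Real.norm_eq_abs] at this

/-- Call-by-value application: the recursor evaluates its argument before the continuation runs. -/
def forceNat {α : Type} (n : ℕ) (k : ℕ → α) : α := Nat.rec (k 0) (fun m _ => k (Nat.succ m)) n

theorem forceNat_eq {α : Type} (n : ℕ) (k : ℕ → α) : forceNat n k = k n := by
  cases n <;> rfl

/-- Fixed-point Horner evaluation of the truncated Bessel series at `x ^ 2 / 4 = p / q` with unit
`S`; the terms of even and odd order are accumulated separately and handed to `F`. -/
def besselHorner (p q S : ℕ) (F : ℕ → ℕ → ℕ) (n : ℕ) : ℕ → ℕ → ℕ :=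
  Nat.rec F
    (fun k ih U V =>
      forceNat (Nat.mul q (Nat.mul (Nat.succ k) (Nat.succ k))) fun m =>
      forceNat (Nat.add S (Nat.div (Nat.mul p V) m)) fun U' =>
      forceNat (Nat.div (Nat.mul p U) m) fun V' => ih U' V') n

theorem besselHorner_spec {p q : ℕ} (hq : 0 < q) (S : ℕ) (F : ℕ → ℕ → ℕ) (k : ℕ) :
    ∀ (U V : ℕ) (u v : ℝ), 0 ≤ u → 0 ≤ v → U ≤ S * u → S * u ≤ U + (u + v) → V ≤ S * v →
      S * v ≤ V + (u + v) →
    ∃ (U₀ V₀ : ℕ) (u₀ v₀ : ℝ), besselHorner p q S F k U V = F U₀ V₀ ∧ 0 ≤ u₀ ∧ 0 ≤ v₀ ∧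
      U₀ ≤ S * u₀ ∧ S * u₀ ≤ U₀ + (u₀ + v₀) ∧ V₀ ≤ S * v₀ ∧ S * v₀ ≤ V₀ + (u₀ + v₀) ∧
      u₀ - v₀ = ∑ j ∈ Finset.range k, (-((p : ℝ) / q)) ^ j / (j.factorial : ℝ) ^ 2
        + (-((p : ℝ) / q)) ^ k / (k.factorial : ℝ) ^ 2 * (u - v) := by
  induction k with
  | zero => intro U V u v h1 h2 h3 h4 h5 h6; exact ⟨U, V, u, v, rfl, h1, h2, h3, h4, h5, h6, by simp⟩
  | succ k ih =>
    intro U V u v hu hv h3 h4 h5 h6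
    set m : ℕ := q * ((k + 1) * (k + 1)) with hm
    have hm0 : 0 < m := by positivity
    have hmr : (0:ℝ) < m := by exact_mod_cast hm0
    set a : ℝ := (p : ℝ) / m with ha
    have ha0 : 0 ≤ a := by positivity
    have hfloor : ∀ W : ℕ, ((p * W / m : ℕ) : ℝ) ≤ a * W ∧ a * W ≤ ((p * W / m : ℕ) : ℝ) + 1 := by
      intro W
      have e : a * W = ((p * W : ℕ) : ℝ) / m := by rw [ha]; push_cast; ring
      rw [e]
      refine ⟨Nat.cast_div_le, ?_⟩
      rw [div_le_iff₀ hmr]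
      have := (Nat.lt_div_mul_add hm0 (a := p * W)).le
      have h' : ((p * W : ℕ) : ℝ) ≤ ((p * W / m : ℕ) : ℝ) * m + m := by exact_mod_cast this
      linarith
    have hV := hfloor V
    have hU := hfloor U
    have m3 := mul_le_mul_of_nonneg_left h3 ha0
    have m4 := mul_le_mul_of_nonneg_left h4 ha0
    have m5 := mul_le_mul_of_nonneg_left h5 ha0
    have m6 := mul_le_mul_of_nonneg_left h6 ha0
    obtain ⟨U₀, V₀, u₀, v₀, h1, h2⟩ := ih (S + p * V / m) (p * U / m) (1 + a * v) (a * u)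
      (by positivity) (by positivity) (by push_cast at hV ⊢; linarith)
      (by push_cast at hV ⊢; linarith) (by linarith) (by linarith)
    refine ⟨U₀, V₀, u₀, v₀, ?_, h2.1, h2.2.1, h2.2.2.1, h2.2.2.2.1, h2.2.2.2.2.1, h2.2.2.2.2.2.1, ?_⟩
    · rw [← h1]
      change forceNat (q * ((k + 1) * (k + 1))) (fun m => forceNat (S + p * V / m) fun U' =>
        forceNat (p * U / m) fun V' => besselHorner p q S F k U' V') = _
      rw [forceNat_eq, forceNat_eq, forceNat_eq]
    · rw [h2.2.2.2.2.2.2, Finset.sum_range_succ, add_assoc]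
      congr 1
      rw [Nat.factorial_succ, ha, hm]
      push_cast
      have hqr : (q : ℝ) ≠ 0 := by positivity
      have hk : (k : ℝ) + 1 ≠ 0 := by positivity
      have hf : (k.factorial : ℝ) ≠ 0 := by positivity
      have hy : (p : ℝ) = p / q * q := by field_simp
      generalize (p : ℝ) / q = y at hy
      rw [hy, pow_succ]
      field_simp
      ring

/-- The integer part of `10 ^ 9 * (2 + J₀(x))` up to an error of three units, where
`x ^ 2 / 4 = p / q`, computed from `n` terms with fixed-point unit `S`; zero if `n` or `S` is
too small. -/
def besselScaled (p q S n : ℕ) : ℕ :=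
  besselHorner p q S (fun U V =>
    cond (and (Nat.ble (Nat.mul 2 p) (Nat.mul q (Nat.mul n n)))
      (and (Nat.ble (Nat.mul (Nat.pow (Nat.mul p 8) n) 1000000000)
          (Nat.pow (Nat.mul q (Nat.mul n n)) n))
        (and (Nat.ble 4 S) (Nat.ble (Nat.mul (Nat.add U V) 8000000000) (Nat.mul S S)))))
      (Nat.div (Nat.mul 1000000000 (Nat.sub (Nat.add U (Nat.mul 2 S)) V)) S) 0) n S 0

theorem besselScaled_spec {p q S n : ℕ} {x : ℝ} (hq : 0 < q) (hx : x ^ 2 / 4 = p / q) :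
    (besselScaled p q S n : ℝ) ≤ 1000000000 * (2 + besselZero x) + 3 ∧
    (besselScaled p q S n ≠ 0 →
      1000000000 * (2 + besselZero x) ≤ (besselScaled p q S n : ℝ) + 3) := by
  have hJ := abs_le.1 (abs_besselZero_le_one x)
  obtain ⟨U, V, u, v, h1, hu, hv, h3, h4, h5, h6, h7⟩ := besselHorner_spec (p := p) hq S (fun U V =>
    cond (and (Nat.ble (Nat.mul 2 p) (Nat.mul q (Nat.mul n n)))
      (and (Nat.ble (Nat.mul (Nat.pow (Nat.mul p 8) n) 1000000000)
          (Nat.pow (Nat.mul q (Nat.mul n n)) n))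
        (and (Nat.ble 4 S) (Nat.ble (Nat.mul (Nat.add U V) 8000000000) (Nat.mul S S)))))
      (Nat.div (Nat.mul 1000000000 (Nat.sub (Nat.add U (Nat.mul 2 S)) V)) S) 0) n S 0 1 0
    (by norm_num) le_rfl (by simp) (by simp) (by simp) (by simp)
  have h0 : (0:ℝ) ≤ 1000000000 * (2 + besselZero x) + 3 := by linarith
  change besselScaled p q S n = _ at h1
  rw [h1]
  cases hc : and (Nat.ble (Nat.mul 2 p) (Nat.mul q (Nat.mul n n)))
      (and (Nat.ble (Nat.mul (Nat.pow (Nat.mul p 8) n) 1000000000)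
          (Nat.pow (Nat.mul q (Nat.mul n n)) n))
        (and (Nat.ble 4 S) (Nat.ble (Nat.mul (Nat.add U V) 8000000000) (Nat.mul S S)))) with
  | false => simpa using h0
  | true =>
  simp only [Bool.and_eq_true] at hc
  obtain ⟨hA, hB, hC, hD⟩ := hc
  have hA : 2 * p ≤ q * (n * n) := Nat.le_of_ble_eq_true hA
  have hB : (p * 8) ^ n * 1000000000 ≤ (q * (n * n)) ^ n := Nat.le_of_ble_eq_true hB
  have hC : 4 ≤ S := Nat.le_of_ble_eq_true hC
  have hD : (U + V) * 8000000000 ≤ S * S := Nat.le_of_ble_eq_true hD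
  have hqr : (0:ℝ) < q := by exact_mod_cast hq
  have hSr : (4:ℝ) ≤ S := by exact_mod_cast hC
  have hn : x ^ 2 / 2 ≤ (n : ℝ) ^ 2 := by
    have : x ^ 2 / 2 = 2 * (p / q) := by rw [← hx]; ring
    rw [this, ← mul_div_assoc, div_le_iff₀ hqr]
    have : (2:ℝ) * p ≤ q * (n * n) := by exact_mod_cast hA
    nlinarith
  have htail := abs_besselZero_sub_sum_le hn
  have hc : (x ^ 2 / 4) ^ n / (n.factorial : ℝ) ^ 2 ≤ 1 / 1000000000 := by
    have hB' : ((p:ℝ) * 8) ^ n * 1000000000 ≤ (q * (n * n)) ^ n := by exact_mod_cast hB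
    have hf : (0:ℝ) < n.factorial := by positivity
    have he : (n : ℝ) ^ n ≤ Real.exp 1 ^ n * n.factorial := by
      have := Real.pow_div_factorial_le_exp (n : ℝ) n.cast_nonneg n
      rw [div_le_iff₀ hf] at this
      rwa [← Real.exp_nat_mul, mul_one]
    have he2 : Real.exp 1 ^ 2 ≤ 8 := by
      have := Real.exp_one_lt_d9
      nlinarith [Real.exp_pos 1]
    have h8 : ((n : ℝ) * n) ^ n ≤ 8 ^ n * (n.factorial : ℝ) ^ 2 := by
      calc ((n : ℝ) * n) ^ n = ((n : ℝ) ^ n) ^ 2 := by rw [mul_pow]; ring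
        _ ≤ (Real.exp 1 ^ n * n.factorial) ^ 2 := by gcongr
        _ = (Real.exp 1 ^ 2) ^ n * (n.factorial : ℝ) ^ 2 := by ring
        _ ≤ _ := by gcongr
    rw [hx, div_pow, div_div, div_le_div_iff₀ (by positivity) (by norm_num)]
    have h9 : (8:ℝ) ^ n * ((p:ℝ) ^ n * 1000000000) ≤ 8 ^ n * (1 * (q ^ n * (n.factorial : ℝ) ^ 2)) := by
      calc (8:ℝ) ^ n * ((p:ℝ) ^ n * 1000000000) = ((p:ℝ) * 8) ^ n * 1000000000 := by
            rw [mul_pow]; ring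
        _ ≤ (q * (n * n)) ^ n := hB'
        _ = q ^ n * ((n : ℝ) * n) ^ n := by rw [mul_pow]
        _ ≤ q ^ n * (8 ^ n * (n.factorial : ℝ) ^ 2) := by gcongr
        _ = _ := by ring
    exact le_of_mul_le_mul_left h9 (by positivity)
  rw [Finset.sum_range_succ, hx] at htail
  rw [sub_zero, mul_one] at h7
  rw [← h7] at htail
  rw [hx] at hc
  have hT := abs_le.1 (htail.trans hc)
  have hDr : ((U:ℝ) + V) * 8000000000 ≤ S * S := by exact_mod_cast hD
  have huv : (u + v) * 2000000000 ≤ S := by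
    have h' : (S : ℝ) * (u + v) ≤ 2 * (U + V) := by nlinarith
    have : (S : ℝ) * ((u + v) * 4000000000) ≤ S * S := by nlinarith
    have := le_of_mul_le_mul_left this (by linarith)
    linarith
  have hVle : V ≤ U + 2 * S := by
    have : (V : ℝ) ≤ U + 2 * S := by nlinarith
    exact_mod_cast this
  have hS0 : 0 < S := by omega
  set W := U + 2 * S - V with hW
  have hWr : (W : ℝ) = U + 2 * S - V := by rw [hW, Nat.cast_sub hVle]; push_cast; ring
  have hz1 : ((1000000000 * W / S : ℕ) : ℝ) ≤ 1000000000 * (2 + (u - v)) + 1 := by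
    refine Nat.cast_div_le.trans ?_
    rw [div_le_iff₀ (by linarith)]
    push_cast
    rw [hWr]
    linarith
  have hz2 : 1000000000 * (2 + (u - v)) ≤ ((1000000000 * W / S : ℕ) : ℝ) + 2 := by
    have := (Nat.lt_div_mul_add hS0 (a := 1000000000 * W)).le
    have h' : ((1000000000 * W : ℕ) : ℝ) ≤ ((1000000000 * W / S : ℕ) : ℝ) * S + S := by
      exact_mod_cast this
    push_cast at h'
    rw [hWr] at h'
    have : S * (1000000000 * (2 + (u - v))) ≤ S * (((1000000000 * W / S : ℕ) : ℝ) + 2) := by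
      linarith
    exact le_of_mul_le_mul_left this (by linarith)
  simp only [cond_true]
  change ((1000000000 * W / S : ℕ) : ℝ) ≤ _ ∧ (_ → _ ≤ ((1000000000 * W / S : ℕ) : ℝ) + 3)
  exact ⟨by linarith, fun _ => by linarith⟩

theorem mul_besselZero_sq_le_of_le {x : ℝ} (hx : 12 / 5 ≤ x) :
    x * besselZero x ^ 2 ≤ 0.67 := by
  have h1 := besselScaled_spec (p := 36) (q := 25) (S := 1000000000000) (n := 12) (x := 12 / 5) (by norm_num)
    (by norm_num)
  have h2 := besselScaled_spec (p := 1452025) (q := 1000000) (S := 1000000000000) (n := 12) (x := 241 / 100)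
    (by norm_num) (by norm_num)
  have e1 : besselScaled 36 25 1000000000000 12 = 2002507683 := by decide +kernel
  have e2 : besselScaled 1452025 1000000 1000000000000 12 = 1997316599 := by decide +kernel
  rw [e1] at h1
  rw [e2] at h2
  obtain ⟨h1a, h1b⟩ := h1
  obtain ⟨h2a, h2b⟩ := h2
  have h1b := h1b (by norm_num)
  have h2b := h2b (by norm_num)
  push_cast at h1a h1b h2a h2b
  obtain ⟨c, hc, hce⟩ := exists_hasDerivAt_eq_slope besselZero besselZeroDeriv
    (a := 12 / 5) (b := 241 / 100) (by norm_num) continuous_besselZero.continuousOn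
    fun y _ => hasDerivAt_besselZero y
  have hd := Convex.norm_image_sub_le_of_norm_hasDerivWithin_le (f := besselZeroDeriv)
    (f' := besselZeroDerivTwo) (s := Set.univ) (C := 1 / 2) (x := c) (y := 12 / 5)
    (fun z _ => (hasDerivAt_besselZeroDeriv z).hasDerivWithinAt)
    (fun z _ => abs_besselZeroDerivTwo_le z) convex_univ trivial trivial
  rw [Real.norm_eq_abs, Real.norm_eq_abs] at hd
  have hcc : |12 / 5 - c| ≤ 1 / 100 := by rw [abs_le]; constructor <;> linarith [hc.1, hc.2]
  have hd' := abs_le.1 (hd.trans (mul_le_mul_of_nonneg_left hcc (by norm_num)))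
  have hlo : -0.526 ≤ besselZeroDeriv (12 / 5) := by
    have : besselZeroDeriv c = (besselZero (241 / 100) - besselZero (12 / 5)) * 100 := by
      rw [hce]; ring
    linarith
  have hhi : besselZeroDeriv (12 / 5) ≤ 0 := by
    have : besselZeroDeriv c = (besselZero (241 / 100) - besselZero (12 / 5)) * 100 := by
      rw [hce]; ring
    linarith
  have hJ0 : 0 ≤ besselZero (12 / 5) := by linarith
  have hJ1 : besselZero (12 / 5) ≤ 0.0026 := by linarith
  refine (mul_besselZero_sq_le (by norm_num) hx).trans ?_
  have hd2 : besselZeroDeriv (12 / 5) ^ 2 ≤ 0.526 ^ 2 := by nlinarith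
  have hJ2 : besselZero (12 / 5) ^ 2 ≤ 0.0026 ^ 2 := by nlinarith
  have hJd := mul_nonneg hJ0 (neg_nonneg.2 hhi)
  norm_num at hd2 hJ2 ⊢
  linarith

/-- The linear programming certificate; `σ` is the short side of the configuration used. -/
noncomputable def certificate (σ t : ℝ) : ℝ :=
  besselZero (1.96 * t) + 0.3783 + 2.0575 * besselZero t - 0.3614 * besselZero (0.94 * t)
    + 0.2788 * (besselZero (σ * t) + 2 * besselZero (1.3 * t))

/-- A function with second derivative at most `M` lies above its chord up to `M h ^ 2 / 8`. -/
theorem min_sub_le_of_deriv_two_le {f f' f'' : ℝ → ℝ} {M : ℝ}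
    (h1 : ∀ x, HasDerivAt f (f' x) x) (h2 : ∀ x, HasDerivAt f' (f'' x) x) (hM : ∀ x, f'' x ≤ M)
    {a b t c : ℝ} (hat : a ≤ t) (htb : t ≤ b) (hM0 : 0 ≤ M) (ha : c ≤ f a) (hb : c ≤ f b) :
    c - M * (b - a) ^ 2 / 8 ≤ f t := by
  have hc : ConcaveOn ℝ Set.univ (fun x => f x - M / 2 * x ^ 2) := by
    refine concaveOn_of_hasDerivWithinAt2_nonpos (f' := fun x => f' x - M * x)
      (f'' := fun x => f'' x - M) convex_univ ?_ ?_ ?_ ?_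
    · exact fun x _ => (((h1 x).sub ((hasDerivAt_pow 2 x).const_mul (M / 2)))).continuousAt.continuousWithinAt
    · intro x _
      refine (((h1 x).sub ((hasDerivAt_pow 2 x).const_mul (M / 2)))).hasDerivWithinAt.congr_deriv ?_
      norm_num; ring
    · intro x _
      refine ((h2 x).sub ((hasDerivAt_id x).const_mul M)).hasDerivWithinAt.congr_deriv ?_
      ring
    · intro x _; linarith [hM x]
  rcases hat.eq_or_lt with rfl | hat'
  · have : 0 ≤ M * (b - a) ^ 2 / 8 := by positivity
    linarith
  have hab : 0 < b - a := by linarith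
  have h := hc.2 (Set.mem_univ a) (Set.mem_univ b)
    (div_nonneg (by linarith : 0 ≤ b - t) hab.le) (div_nonneg (by linarith : 0 ≤ t - a) hab.le)
    (by field_simp; ring)
  simp only [smul_eq_mul] at h
  have e : (b - t) / (b - a) * a + (t - a) / (b - a) * b = t := by field_simp; ring
  rw [e] at h
  have h3 : (b - t) / (b - a) * c ≤ (b - t) / (b - a) * f a :=
    mul_le_mul_of_nonneg_left ha (div_nonneg (by linarith) hab.le)
  have h4 : (t - a) / (b - a) * c ≤ (t - a) / (b - a) * f b :=
    mul_le_mul_of_nonneg_left hb (div_nonneg (by linarith) hab.le)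
  have e2 : (b - t) / (b - a) * c + (t - a) / (b - a) * c = c := by field_simp; ring
  have e3 : (b - t) / (b - a) * (M / 2 * a ^ 2) + (t - a) / (b - a) * (M / 2 * b ^ 2)
      - M / 2 * t ^ 2 = M / 2 * ((b - t) * (t - a)) := by field_simp; ring
  have e4 : M / 2 * ((b - t) * (t - a)) ≤ M * (b - a) ^ 2 / 8 := by
    nlinarith [mul_nonneg hM0 (sq_nonneg ((b - t) - (t - a)))]
  linarith

/-- `besselScaled` at the argument `ρ / 1000 * (τ / 50)`. -/
def besselNode (ρ τ : ℕ) : ℕ :=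
  forceNat (Nat.mul ρ τ) fun m => forceNat (Nat.mul m m) fun p =>
  forceNat (Nat.pow 2 300) fun S => forceNat (Nat.add 10 (Nat.div (Nat.mul 3 m) 100000)) fun n =>
    besselScaled p 10000000000 S n

/-- The difference between `w₁ z₁ + w₂ z₂ + w₃ z₃ + w₄ z₄ + c` and `w₅ z₅ + d`; zero if `z₅` is
missing. -/
def nodeCombine (w₁ w₂ w₃ w₄ w₅ c d z₁ z₂ z₃ z₄ z₅ : ℕ) : ℕ :=
  cond (Nat.beq z₅ 0) 0
    (Nat.sub (Nat.add (Nat.mul w₁ z₁) (Nat.add (Nat.mul w₂ z₂)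
      (Nat.add (Nat.mul w₃ z₃) (Nat.add (Nat.mul w₄ z₄) c)))) (Nat.add (Nat.mul w₅ z₅) d))

/-- A lower bound for `10 ^ 13` times the certificate at `τ / 50`. -/
def nodeValue (τ : ℕ) : ℕ :=
  forceNat (besselNode 1960 τ) fun z₁ => forceNat (besselNode 1000 τ) fun z₂ =>
  forceNat (besselNode 334 τ) fun z₃ => forceNat (besselNode 1300 τ) fun z₄ =>
  forceNat (besselNode 940 τ) fun z₅ =>
    nodeCombine 10000 20575 2788 5576 3614 3783000000000 70650000200000 z₁ z₂ z₃ z₄ z₅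

/-- The margin needed on the interval between two nodes. -/
def nodeMargin (τ τ' : ℕ) : ℕ :=
  Nat.add (Nat.mul 1800000000 (Nat.mul (Nat.sub τ' τ) (Nat.sub τ' τ))) (Nat.mul 1440000 τ')

/-- Check that consecutive nodes have enough margin and that the last one is at least `4100`. -/
def checkNodes (l : List ℕ) : ℕ → ℕ → Bool :=
  List.rec (fun τ _ => Nat.ble 4100 τ)
    (fun τ' _ ih τ v => forceNat (nodeValue τ') fun v' => forceNat (nodeMargin τ τ') fun m =>
      and (Nat.ble τ τ') (and (Nat.blt m v) (and (Nat.blt m v') (ih τ' v')))) l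

set_option exponentiation.threshold 400 in
theorem besselNode_spec (ρ τ : ℕ) :
    (besselNode ρ τ : ℝ) ≤ 1000000000 * (2 + besselZero (ρ / 1000 * (τ / 50))) + 3 ∧
    (besselNode ρ τ ≠ 0 →
      1000000000 * (2 + besselZero (ρ / 1000 * (τ / 50))) ≤ (besselNode ρ τ : ℝ) + 3) := by
  have e : besselNode ρ τ = besselScaled ((ρ * τ) * (ρ * τ)) 10000000000 (2 ^ 300)
      (10 + 3 * (ρ * τ) / 100000) := by
    unfold besselNode
    simp only [forceNat_eq]
    rfl
  rw [e]
  refine besselScaled_spec (by norm_num) ?_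
  push_cast
  ring

theorem nodeCombine_spec {w₁ w₂ w₃ w₄ w₅ c d z₁ z₂ z₃ z₄ z₅ : ℕ}
    (h : 0 < nodeCombine w₁ w₂ w₃ w₄ w₅ c d z₁ z₂ z₃ z₄ z₅) : z₅ ≠ 0 ∧
    (nodeCombine w₁ w₂ w₃ w₄ w₅ c d z₁ z₂ z₃ z₄ z₅ : ℝ)
      = w₁ * z₁ + w₂ * z₂ + w₃ * z₃ + w₄ * z₄ + c - (w₅ * z₅ + d) := by
  rcases Nat.eq_zero_or_pos z₅ with rfl | h5
  · exact absurd h (by simp [nodeCombine])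
  have e : nodeCombine w₁ w₂ w₃ w₄ w₅ c d z₁ z₂ z₃ z₄ z₅ = (w₁ * z₁ + (w₂ * z₂ + (w₃ * z₃ + (w₄ * z₄
      + c)))) - (w₅ * z₅ + d) := by
    have : Nat.beq z₅ 0 = false := by
      cases hb : Nat.beq z₅ 0 with
      | false => rfl
      | true => exact absurd (Nat.eq_of_beq_eq_true hb) h5.ne'
    unfold nodeCombine
    rw [this]
    rfl
  rw [e] at h ⊢
  refine ⟨h5.ne', ?_⟩
  rw [Nat.cast_sub (Nat.lt_of_sub_pos h).le]
  push_cast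
  ring

theorem nodeValue_spec {τ : ℕ} (h : 0 < nodeValue τ) :
    (nodeValue τ : ℝ) ≤ 10000000000000 * certificate 0.334 (τ / 50) := by
  unfold nodeValue at h ⊢
  simp only [forceNat_eq] at h ⊢
  obtain ⟨hz, hv⟩ := nodeCombine_spec h
  rw [hv]
  simp only [Nat.cast_ofNat]
  have h1 := (besselNode_spec 1960 τ).1
  have h2 := (besselNode_spec 1000 τ).1
  have h3 := (besselNode_spec 334 τ).1
  have h4 := (besselNode_spec 1300 τ).1
  have h5 := (besselNode_spec 940 τ).2 hz
  clear hv h hz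
  generalize (besselNode 1960 τ : ℝ) = z₁ at *
  generalize (besselNode 1000 τ : ℝ) = z₂ at *
  generalize (besselNode 334 τ : ℝ) = z₃ at *
  generalize (besselNode 1300 τ : ℝ) = z₄ at *
  generalize (besselNode 940 τ : ℝ) = z₅ at *
  unfold certificate
  norm_num at h1 h2 h3 h4 h5 ⊢
  linarith

theorem exists_hasDerivAt_certificate (σ : ℝ) (hσ : |σ| ≤ 0.334) : ∃ f' f'' : ℝ → ℝ,
    (∀ x, HasDerivAt (certificate σ) (f' x) x) ∧ (∀ x, HasDerivAt f' (f'' x) x) ∧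
      ∀ x, f'' x ≤ 3.6 := by
  have d1 : ∀ r x : ℝ, HasDerivAt (fun t => besselZero (r * t)) (r * besselZeroDeriv (r * x)) x :=
    fun r x => ((hasDerivAt_besselZero (r * x)).comp x ((hasDerivAt_id x).const_mul r)).congr_deriv
      (by ring)
  have d2 : ∀ r x : ℝ, HasDerivAt (fun t => r * besselZeroDeriv (r * t))
      (r ^ 2 * besselZeroDerivTwo (r * x)) x :=
    fun r x => (((hasDerivAt_besselZeroDeriv (r * x)).comp x
      ((hasDerivAt_id x).const_mul r)).const_mul r).congr_deriv (by ring)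
  refine ⟨fun x => 1.96 * besselZeroDeriv (1.96 * x) + 2.0575 * (1 * besselZeroDeriv (1 * x))
      - 0.3614 * (0.94 * besselZeroDeriv (0.94 * x))
      + 0.2788 * (σ * besselZeroDeriv (σ * x) + 2 * (1.3 * besselZeroDeriv (1.3 * x))),
    fun x => 1.96 ^ 2 * besselZeroDerivTwo (1.96 * x)
      + 2.0575 * (1 ^ 2 * besselZeroDerivTwo (1 * x))
      - 0.3614 * (0.94 ^ 2 * besselZeroDerivTwo (0.94 * x))
      + 0.2788 * (σ ^ 2 * besselZeroDerivTwo (σ * x)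
        + 2 * (1.3 ^ 2 * besselZeroDerivTwo (1.3 * x))), ?_, ?_, ?_⟩
  · intro x
    have := ((((d1 1.96 x).add_const 0.3783).add ((d1 1 x).const_mul 2.0575)).sub
      ((d1 0.94 x).const_mul 0.3614)).add
        (((d1 σ x).add ((d1 1.3 x).const_mul 2)).const_mul 0.2788)
    refine this.congr_of_eventuallyEq (Eventually.of_forall fun t => ?_)
    simp only [certificate, Pi.add_apply, Pi.sub_apply, one_mul]
  · intro x
    exact ((((d2 1.96 x)).add ((d2 1 x).const_mul 2.0575)).sub
      ((d2 0.94 x).const_mul 0.3614)).add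
        (((d2 σ x).add ((d2 1.3 x).const_mul 2)).const_mul 0.2788)
  · intro x
    have h1 := abs_le.1 (abs_besselZeroDerivTwo_le (1.96 * x))
    have h2 := abs_le.1 (abs_besselZeroDerivTwo_le (1 * x))
    have h3 := abs_le.1 (abs_besselZeroDerivTwo_le (0.94 * x))
    have h4 := abs_le.1 (abs_besselZeroDerivTwo_le (σ * x))
    have h5 := abs_le.1 (abs_besselZeroDerivTwo_le (1.3 * x))
    have hs : σ ^ 2 ≤ 0.334 ^ 2 := sq_le_sq' (by linarith [(abs_le.1 hσ).1]) (abs_le.1 hσ).2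
    have h6 : σ ^ 2 * besselZeroDerivTwo (σ * x) ≤ 0.334 ^ 2 * (1 / 2) := by
      nlinarith [sq_nonneg σ, h4.2]
    norm_num at h6 h1 h2 h3 h5 ⊢
    linarith

theorem certificate_of_checkNodes (l : List ℕ) : ∀ τ v : ℕ, (v = nodeValue τ) →
    checkNodes l τ v = true → ∀ t : ℝ, (τ : ℝ) / 50 ≤ t → t ≤ 82 →
      (t = τ / 50 ∧ l = []) ∨ 0.0000072 * t ≤ certificate 0.334 t := by
  obtain ⟨f', f'', hf', hf'', hM⟩ := exists_hasDerivAt_certificate 0.334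
    (by rw [abs_of_pos (by norm_num)])
  induction l with
  | nil =>
    intro τ v _ hc t ht1 ht2
    have h : 4100 ≤ τ := Nat.le_of_ble_eq_true hc
    have h' : (4100:ℝ) ≤ τ := by exact_mod_cast h
    exact Or.inl ⟨by linarith, rfl⟩
  | cons τ' l ih =>
    intro τ v hv hc t ht1 ht2
    right
    have hc' : (Nat.ble τ τ' && (Nat.blt (nodeMargin τ τ') v &&
        (Nat.blt (nodeMargin τ τ') (nodeValue τ') && checkNodes l τ' (nodeValue τ')))) = true := by
      rw [← hc]
      change _ = forceNat (nodeValue τ') (fun v' => forceNat (nodeMargin τ τ') fun m =>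
        and (Nat.ble τ τ') (and (Nat.blt m v) (and (Nat.blt m v') (checkNodes l τ' v'))))
      rw [forceNat_eq, forceNat_eq]
    simp only [Bool.and_eq_true] at hc'
    obtain ⟨h1, h2, h3, h4⟩ := hc'
    have h1 : τ ≤ τ' := Nat.le_of_ble_eq_true h1
    have h2 : nodeMargin τ τ' + 1 ≤ v := Nat.le_of_ble_eq_true h2
    have h3 : nodeMargin τ τ' + 1 ≤ nodeValue τ' := Nat.le_of_ble_eq_true h3
    have key : ∀ t : ℝ, (τ : ℝ) / 50 ≤ t → t ≤ (τ' : ℝ) / 50 →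
        0.0000072 * t ≤ certificate 0.334 t := by
      intro t ht1 ht2
      have hm : (nodeMargin τ τ' : ℝ) = 1800000000 * ((τ' : ℝ) - τ) ^ 2 + 1440000 * τ' := by
        change ((1800000000 * ((τ' - τ) * (τ' - τ)) + 1440000 * τ' : ℕ) : ℝ) = _
        push_cast [Nat.cast_sub h1]
        ring
      have h2' : (nodeMargin τ τ' : ℝ) + 1 ≤ nodeValue τ := by rw [← hv]; exact_mod_cast h2
      have h3' : (nodeMargin τ τ' : ℝ) + 1 ≤ nodeValue τ' := by exact_mod_cast h3
      have ha := nodeValue_spec (τ := τ) (by omega)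
      have hb := nodeValue_spec (τ := τ') (by omega)
      have := min_sub_le_of_deriv_two_le hf' hf'' hM ht1 ht2 (by norm_num)
        (c := (nodeMargin τ τ' : ℝ) / 10000000000000) (by linarith) (by linarith)
      rw [hm] at this
      refine le_trans ?_ this
      norm_num
      nlinarith
    rcases le_total t ((τ' : ℝ) / 50) with htt | htt
    · exact key t ht1 htt
    · rcases ih τ' (nodeValue τ') rfl h4 t htt ht2 with h | h
      · exact key t ht1 h.1.le
      · exact h

theorem checkNodes_eq_true : checkNodes
    [80, 115, 132, 143, 153, 163, 175, 188, 198, 206, 212, 217, 222, 228, 237, 253, 283, 339, 390, 416, 430, 437, 442, 447, 452, 460, 473, 493, 517, 534, 545, 552, 557, 562, 567, 574, 587, 610, 652, 706, 742, 770, 798, 824, 847, 869, 891, 922, 974, 1031, 1066, 1090, 1114, 1138, 1168, 1204, 1248, 1308, 1351, 1375, 1388, 1396, 1402, 1408, 1415, 1425, 1441, 1465, 1497, 1533, 1572, 1623, 1669, 1701, 1727, 1753, 1782, 1815, 1851, 1894, 1953, 2000, 2030, 2052, 2075, 2100, 2132, 2172, 2222, 2279, 2316, 2337, 2349, 2357,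 2365, 2373, 2383, 2399, 2424, 2459, 2501, 2548, 2601, 2640, 2669, 2697, 2725, 2759, 2799, 2844, 2899, 2949, 2982, 3008, 3034, 3063, 3100, 3145, 3198, 3248, 3280, 3300, 3315, 3330, 3346, 3369, 3403, 3446, 3493, 3545, 3587, 3619, 3650, 3681, 3719, 3764, 3812, 3867, 3913, 3946, 3977, 4008, 4046, 4092, 4143] 0 (nodeValue 0) = true := by decide +kernel

theorem certificate_nonneg {σ t : ℝ} (hσ : |σ - 0.334| ≤ 0.0000256) (ht : 0 ≤ t) :
    0 ≤ certificate σ t := by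
  have hσ' := abs_le.1 hσ
  rcases le_total t 82 with h | h
  · have h1 : 0.0000072 * t ≤ certificate 0.334 t := by
      rcases certificate_of_checkNodes _ 0 (nodeValue 0) rfl checkNodes_eq_true t (by simpa using ht)
        h with h | h
      · exact absurd h.2 (by simp)
      · exact h
    have h2 := abs_besselZero_sub_le (σ * t) (0.334 * t)
    rw [← sub_mul, abs_mul, abs_of_nonneg ht] at h2
    have h3 := abs_le.1 (h2.trans (mul_le_mul_of_nonneg_right hσ ht))
    unfold certificate at h1 ⊢
    nlinarith
  · have hJ : ∀ r κ : ℝ, 0.03 ≤ r → 0 ≤ κ → 0.67 ≤ 82 * r * κ ^ 2 → |besselZero (r * t)| ≤ κ := by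
      intro r κ hr hκ h'
      have hrt : 82 * r ≤ r * t := by nlinarith
      have h1 := mul_besselZero_sq_le_of_le (x := r * t) (by nlinarith)
      rw [← sq_le_sq₀ (abs_nonneg _) hκ, sq_abs]
      by_contra hcon
      push Not at hcon
      nlinarith [mul_pos (by linarith : 0 < r) (by linarith : 0 < t)]
    have h1 := abs_le.1 (hJ 1.96 0.0646 (by norm_num) (by norm_num) (by norm_num))
    have h2 := abs_le.1 (hJ 1 0.0904 (by norm_num) (by norm_num) (by norm_num))
    have h3 := abs_le.1 (hJ 0.94 0.0933 (by norm_num) (by norm_num) (by norm_num))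
    have h4 := abs_le.1 (hJ σ 0.1565 (by linarith) (by norm_num) (by nlinarith))
    have h5 := abs_le.1 (hJ 1.3 0.0793 (by norm_num) (by norm_num) (by norm_num))
    rw [one_mul] at h2
    unfold certificate
    linarith

/-- The two-dimensional unit torus. -/
abbrev Torus : Type := UnitAddTorus (Fin 2)

lemma pi_haarAddCircle_eq_volume :
    (Measure.pi fun _ : Fin 2 => (AddCircle.haarAddCircle : Measure UnitAddCircle)) =
      (volume : Measure Torus) := by
  have : (AddCircle.haarAddCircle : Measure UnitAddCircle) = volume := by
    rw [AddCircle.volume_eq_smul_haarAddCircle]; simp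
  rw [this]; rfl

instance : IsProbabilityMeasure (volume : Measure UnitAddCircle) := ⟨by simp⟩


/-- The autocorrelation of a function on the torus. -/
noncomputable def corr (w : Torus → ℝ) (z : Torus) : ℝ := ∫ y, w y * w (y + z)

/-- The squared modulus of the `k`-th Fourier coefficient of a real function. -/
noncomputable def fourierWeight (w : Torus → ℝ) (k : Fin 2 → ℤ) : ℝ :=
  (∫ y, w y * (UnitAddTorus.mFourier k y).re) ^ 2 + (∫ y, w y * (UnitAddTorus.mFourier k y).im) ^ 2

lemma fourierWeight_nonneg (w : Torus → ℝ) (k : Fin 2 → ℤ) : 0 ≤ fourierWeight w k := by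
  unfold fourierWeight; positivity

lemma norm_mFourier_apply (k : Fin 2 → ℤ) (y : Torus) : ‖UnitAddTorus.mFourier k y‖ = 1 := by
  simp [UnitAddTorus.mFourier, fourier_apply, norm_prod, Circle.norm_coe, -Fin.prod_univ_two]

lemma mFourier_apply_add (k : Fin 2 → ℤ) (y z : Torus) : UnitAddTorus.mFourier k (y + z) =
    UnitAddTorus.mFourier k y * UnitAddTorus.mFourier k z := by
  simp [UnitAddTorus.mFourier, fourier_apply, smul_add, AddCircle.toCircle_add]
  ring

lemma norm_integral_mFourier_sq {w : Torus → ℝ} (hw : Integrable w) (k : Fin 2 → ℤ) :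
    ‖∫ y : Torus, UnitAddTorus.mFourier (-k) y * (w y : ℂ)‖ ^ 2 = fourierWeight w k := by
  have hi : Integrable (fun y : Torus => UnitAddTorus.mFourier (-k) y * (w y : ℂ)) := by
    refine (hw.ofReal (𝕜 := ℂ)).bdd_mul (c := 1)
      (UnitAddTorus.mFourier (-k)).continuous.aestronglyMeasurable
      (ae_of_all _ fun y => (norm_mFourier_apply _ _).le)
  have hre := Complex.reCLM.integral_comp_comm hi
  have him := Complex.imCLM.integral_comp_comm hi
  simp only [Complex.reCLM_apply, Complex.imCLM_apply] at hre him
  rw [← Complex.normSq_eq_norm_sq, Complex.normSq_apply, ← hre, ← him, fourierWeight]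
  simp only [UnitAddTorus.mFourier_neg, Complex.mul_re, Complex.mul_im, Complex.conj_re,
    Complex.conj_im, Complex.ofReal_re, Complex.ofReal_im, mul_zero, sub_zero, zero_add, neg_mul,
    integral_neg, mul_comm (w _)]
  ring

lemma hasSum_corr {w : Torus → ℝ} (hw : Measurable w) (hb : ∀ y, |w y| ≤ 1) (z : Torus) :
    HasSum (fun k => fourierWeight w k * (UnitAddTorus.mFourier k z).re) (corr w z) := by
  have hm : ∀ z : Torus, MemLp (fun y => (w (y + z) : ℂ)) 2 (volume : Measure Torus) := fun z =>
    MemLp.of_bound (Complex.measurable_ofReal.comp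
      (hw.comp (measurable_add_const z))).aestronglyMeasurable 1
      (ae_of_all _ fun y => by simpa using hb _)
  have hm0 : MemLp (fun y => (w y : ℂ)) 2 (volume : Measure Torus) := by simpa using hm 0
  have hwi : Integrable w := Integrable.of_bound hw.aestronglyMeasurable 1 (ae_of_all _ hb)
  rw [← pi_haarAddCircle_eq_volume] at hm hm0
  set f := hm0.toLp with hf
  set g := (hm z).toLp with hg
  have hfae : f =ᵐ[_] _ := hm0.coeFn_toLp
  have hgae : g =ᵐ[_] _ := (hm z).coeFn_toLp
  have key := UnitAddTorus.hasSum_prod_mFourierCoeff f g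
  have hcf : ∀ k, UnitAddTorus.mFourierCoeff f k =
      ∫ y : Torus, UnitAddTorus.mFourier (-k) y * (w y : ℂ) := by
    intro k
    rw [← pi_haarAddCircle_eq_volume]
    refine integral_congr_ae ?_
    filter_upwards [hfae] with y hy
    rw [hy, smul_eq_mul]
  have hcg : ∀ k, UnitAddTorus.mFourierCoeff g k =
      UnitAddTorus.mFourier k z * ∫ y : Torus, UnitAddTorus.mFourier (-k) y * (w y : ℂ) := by
    intro k
    have : UnitAddTorus.mFourierCoeff g k =
        ∫ y : Torus, UnitAddTorus.mFourier (-k) y * (w (y + z) : ℂ) := by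
      rw [← pi_haarAddCircle_eq_volume]
      refine integral_congr_ae ?_
      filter_upwards [hgae] with y hy
      rw [hy, smul_eq_mul]
    rw [this, ← integral_const_mul, ← integral_add_right_eq_self
      (fun y : Torus => UnitAddTorus.mFourier k z * (UnitAddTorus.mFourier (-k) y * (w y : ℂ))) z]
    congr 1; ext y
    rw [mFourier_apply_add, UnitAddTorus.mFourier_neg (x := z)]
    have : UnitAddTorus.mFourier k z * (starRingEnd ℂ) (UnitAddTorus.mFourier k z) = 1 := by
      rw [Complex.mul_conj, Complex.normSq_eq_norm_sq, norm_mFourier_apply]; simp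
    linear_combination (- UnitAddTorus.mFourier (-k) y * (w (y + z) : ℂ)) * this
  have hint : (∫ t, (starRingEnd ℂ) (f t) * g t
      ∂(Measure.pi fun _ : Fin 2 => (AddCircle.haarAddCircle : Measure UnitAddCircle)))
      = ((corr w z : ℝ) : ℂ) := by
    rw [corr, ← integral_complex_ofReal, ← pi_haarAddCircle_eq_volume]
    refine integral_congr_ae ?_
    filter_upwards [hfae, hgae] with y hy hy'
    rw [hy, hy']; simp
  have key2 := Complex.hasSum_re key
  have hint' : (∫ t, (starRingEnd ℂ) (f t) * g t
      ∂(Measure.pi fun _ : Fin 2 => (AddCircle.haarAddCircle : Measure UnitAddCircle))).re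
      = corr w z := by rw [hint, Complex.ofReal_re]
  rw [← hint']
  refine HasSum.congr_fun key2 fun k => ?_
  rw [hcf, hcg, ← norm_integral_mFourier_sq hwi, mul_left_comm, mul_comm ((starRingEnd ℂ) _),
    Complex.mul_conj, Complex.normSq_eq_norm_sq, Complex.re_mul_ofReal, mul_comm]

lemma hasSum_fourierWeight {w : Torus → ℝ} (hw : Measurable w) (hb : ∀ y, |w y| ≤ 1) :
    HasSum (fourierWeight w) (∫ y, w y ^ 2) := by
  simpa [corr, UnitAddTorus.mFourier, sq] using hasSum_corr hw hb 0

lemma fourierWeight_zero (w : Torus → ℝ) : fourierWeight w 0 = (∫ y, w y) ^ 2 := by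
  simp [fourierWeight, UnitAddTorus.mFourier_zero]

/-- The class on the unit torus of the vector `(x, y)` rescaled by `1 / K`. -/
noncomputable def shift (K x y : ℝ) : Torus :=
  ![((x / K : ℝ) : UnitAddCircle), ((y / K : ℝ) : UnitAddCircle)]

lemma continuous_shift (K : ℝ) {α : Type*} [TopologicalSpace α] {f g : α → ℝ} (hf : Continuous f)
    (hg : Continuous g) : Continuous fun t => shift K (f t) (g t) := by
  refine continuous_pi fun i => ?_
  fin_cases i
  · exact (AddCircle.continuous_mk' 1).comp (hf.div_const K)
  · exact (AddCircle.continuous_mk' 1).comp (hg.div_const K)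

lemma shift_add (K x y x' y' : ℝ) : shift K (x + x') (y + y') = shift K x y + shift K x' y' := by
  ext i; fin_cases i <;> simp [shift, add_div]

lemma re_mFourier_shift (K x y : ℝ) (k : Fin 2 → ℤ) :
    (UnitAddTorus.mFourier k (shift K x y)).re = Real.cos (2 * Real.pi / K * (k 0 * x + k 1 * y)) := by
  have : UnitAddTorus.mFourier k (shift K x y) =
      Complex.exp ((2 * Real.pi / K * (k 0 * x + k 1 * y) : ℝ) * Complex.I) := by
    simp only [UnitAddTorus.mFourier, shift, ContinuousMap.coe_mk, Fin.prod_univ_two,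
      Matrix.cons_val_zero, Matrix.cons_val_one, fourier_coe_apply, ← Complex.exp_add]
    congr 1
    push_cast
    ring
  rw [this, Complex.exp_ofReal_mul_I_re]

/-- The Euclidean length of the frequency `2πk / K`. -/
noncomputable def freq (K : ℝ) (k : Fin 2 → ℤ) : ℝ :=
  2 * Real.pi / K * √((k 0 : ℝ) ^ 2 + (k 1 : ℝ) ^ 2)

lemma continuous_corr {w : Torus → ℝ} (hw : Measurable w) (hb : ∀ y, |w y| ≤ 1) :
    Continuous (corr w) := by
  have : corr w = fun z => ∑' k, fourierWeight w k * (UnitAddTorus.mFourier k z).re := by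
    ext z; exact (hasSum_corr hw hb z).tsum_eq.symm
  rw [this]
  refine continuous_tsum (u := fourierWeight w) (fun k => ?_) (hasSum_fourierWeight hw hb).summable
    fun k z => ?_
  · exact continuous_const.mul (Complex.continuous_re.comp (UnitAddTorus.mFourier k).continuous)
  · rw [norm_mul, Real.norm_of_nonneg (fourierWeight_nonneg w k)]
    exact mul_le_of_le_one_right (fourierWeight_nonneg w k)
      ((Complex.abs_re_le_norm _).trans (norm_mFourier_apply k z).le)

/-- The average of the autocorrelation of `w` over the rotations of the vector `(x, y)`. -/
noncomputable def rotCorr (K : ℝ) (w : Torus → ℝ) (x y : ℝ) : ℝ :=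
  1 / (2 * Real.pi) * ∫ θ in (0 : ℝ)..(2 * Real.pi),
    corr w (shift K (x * Real.cos θ - y * Real.sin θ) (x * Real.sin θ + y * Real.cos θ))

lemma hasSum_rotCorr {K : ℝ} (hK : 0 < K) {w : Torus → ℝ} (hw : Measurable w)
    (hb : ∀ y, |w y| ≤ 1) (x y : ℝ) :
    HasSum (fun k => fourierWeight w k * besselZero (freq K k * √(x ^ 2 + y ^ 2)))
      (rotCorr K w x y) := by
  have key : HasSum (fun k => ∫ θ in (0 : ℝ)..(2 * Real.pi), fourierWeight w k *
      (UnitAddTorus.mFourier k (shift K (x * Real.cos θ - y * Real.sin θ)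
        (x * Real.sin θ + y * Real.cos θ))).re)
      (∫ θ in (0 : ℝ)..(2 * Real.pi),
    corr w (shift K (x * Real.cos θ - y * Real.sin θ) (x * Real.sin θ + y * Real.cos θ))) := by
    refine intervalIntegral.hasSum_integral_of_dominated_convergence
      (fun k _ => fourierWeight w k) (fun k => ?_) (fun k => ?_) ?_ ?_ ?_
    · refine Continuous.aestronglyMeasurable (continuous_const.mul (Complex.continuous_re.comp
        ((UnitAddTorus.mFourier k).continuous.comp (continuous_shift K ?_ ?_)))) <;> fun_prop
    · refine ae_of_all _ fun θ _ => ?_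
      rw [norm_mul, Real.norm_of_nonneg (fourierWeight_nonneg w k)]
      exact mul_le_of_le_one_right (fourierWeight_nonneg w k)
        ((Complex.abs_re_le_norm _).trans (norm_mFourier_apply k _).le)
    · exact ae_of_all _ fun θ _ => (hasSum_fourierWeight hw hb).summable
    · exact intervalIntegrable_const
    · exact ae_of_all _ fun θ _ => hasSum_corr hw hb _
  refine HasSum.congr_fun (key.mul_left (1 / (2 * Real.pi))) fun k => ?_
  rw [intervalIntegral.integral_const_mul]
  simp only [re_mFourier_shift]
  have h1 : ∀ θ, 2 * Real.pi / K * (k 0 * (x * Real.cos θ - y * Real.sin θ) +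
      k 1 * (x * Real.sin θ + y * Real.cos θ)) =
      (2 * Real.pi / K * (k 0 * x + k 1 * y)) * Real.cos θ +
      (2 * Real.pi / K * (k 1 * x - k 0 * y)) * Real.sin θ := fun θ => by ring
  simp only [h1]
  rw [mul_left_comm, average_cos_eq_besselZero]
  congr 2
  rw [freq, mul_assoc, ← Real.sqrt_mul (by positivity), ← Real.sqrt_sq
    (show 0 ≤ 2 * Real.pi / K by positivity), ← Real.sqrt_mul (by positivity),
    Real.sqrt_sq (by positivity)]
  congr 1
  ring

/-- A subset of the unit torus which, rescaled by `K`, almost surely avoids unit distances. -/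
def Avoiding (K : ℝ) (B : Set Torus) : Prop :=
  ∀ θ : ℝ, volume (B ∩ (fun y => y + shift K (Real.cos θ) (Real.sin θ)) ⁻¹' B) = 0

/-- The real indicator function of a set. -/
noncomputable def ind (B : Set Torus) : Torus → ℝ := B.indicator fun _ => 1

lemma ind_nonneg (B : Set Torus) (y : Torus) : 0 ≤ ind B y :=
  Set.indicator_nonneg (fun _ _ => zero_le_one) y

lemma ind_le_one (B : Set Torus) (y : Torus) : ind B y ≤ 1 :=
  Set.indicator_le' (fun _ _ => le_rfl) (fun _ _ => zero_le_one) y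

lemma abs_ind_le_one (B : Set Torus) (y : Torus) : |ind B y| ≤ 1 := by
  rw [abs_of_nonneg (ind_nonneg B y)]; exact ind_le_one B y

lemma measurable_ind {B : Set Torus} (hB : MeasurableSet B) : Measurable (ind B) :=
  measurable_const.indicator hB

lemma integral_ind {B : Set Torus} (hB : MeasurableSet B) : ∫ y, ind B y = volume.real B := by
  simp [ind, integral_indicator hB]

lemma ind_sq (B : Set Torus) (y : Torus) : ind B y ^ 2 = ind B y := by
  by_cases h : y ∈ B <;> simp [ind, h]

lemma ind_mul_ind_add (B : Set Torus) (z y : Torus) :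
    ind B y * ind B (y + z) = ind (B ∩ (fun y => y + z) ⁻¹' B) y := by
  by_cases h : y ∈ B <;> by_cases h' : y + z ∈ B <;> simp [ind, h, h']

lemma corr_ind {B : Set Torus} (hB : MeasurableSet B) (z : Torus) :
    corr (ind B) z = volume.real (B ∩ (fun y => y + z) ⁻¹' B) := by
  rw [corr, ← integral_ind (hB.inter (measurable_add_const z hB))]
  simp only [ind_mul_ind_add]

lemma corr_nonneg {w : Torus → ℝ} (hw : ∀ y, 0 ≤ w y) (z : Torus) : 0 ≤ corr w z :=
  integral_nonneg fun _ => mul_nonneg (hw _) (hw _)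

lemma rotCorr_nonneg (K : ℝ) {w : Torus → ℝ} (hw : ∀ y, 0 ≤ w y) (x y : ℝ) :
    0 ≤ rotCorr K w x y :=
  mul_nonneg (by positivity) (intervalIntegral.integral_nonneg (by positivity)
    fun _ _ => corr_nonneg hw _)

lemma intervalIntegrable_corr_rot (K : ℝ) {w : Torus → ℝ} (hw : Measurable w)
    (hb : ∀ y, |w y| ≤ 1) (x y a b : ℝ) :
    IntervalIntegrable (fun θ => corr w (shift K (x * Real.cos θ - y * Real.sin θ)
      (x * Real.sin θ + y * Real.cos θ))) volume a b :=
  ((continuous_corr hw hb).comp (continuous_shift K (by fun_prop)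
    (by fun_prop))).intervalIntegrable _ _

lemma Avoiding.rotCorr_eq_zero {K : ℝ} {B : Set Torus} (hB : MeasurableSet B)
    (h : Avoiding K B) : rotCorr K (ind B) 1 0 = 0 := by
  simp [rotCorr, corr_ind hB, measureReal_def, h _]

lemma Avoiding.ae_not_mem {K : ℝ} {B : Set Torus} (h : Avoiding K B) (p q p' q' φ : ℝ)
    (hp : p' = p + Real.cos φ) (hq : q' = q + Real.sin φ) :
    ∀ᵐ y : Torus, ind B (y + shift K p q) = 0 ∨ ind B (y + shift K p' q') = 0 := by
  have h1 : ∀ᵐ y : Torus, ¬ (y ∈ B ∧ y + shift K (Real.cos φ) (Real.sin φ) ∈ B) := by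
    have := h φ
    rw [ae_iff]; simpa [Set.inter_def] using this
  filter_upwards [(measurePreserving_add_right volume (shift K p q)).quasiMeasurePreserving.ae h1]
    with y hy
  rw [add_assoc, ← shift_add, ← hp, ← hq] at hy
  by_contra! hc
  exact hy ⟨by by_contra h; exact hc.1 (by simp [ind, h]), by by_contra h; exact hc.2 (by simp [ind, h])⟩

lemma Avoiding.corr_triangle_le {K : ℝ} {B : Set Torus} (hB : MeasurableSet B)
    (h : Avoiding K B) (s θ : ℝ) :
    corr (ind B) (shift K (s * Real.cos θ - 0 * Real.sin θ) (s * Real.sin θ + 0 * Real.cos θ)) +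
    corr (ind B) (shift K ((s + √3 / 2) * Real.cos θ - 1 / 2 * Real.sin θ)
      ((s + √3 / 2) * Real.sin θ + 1 / 2 * Real.cos θ)) +
    corr (ind B) (shift K ((s + √3 / 2) * Real.cos θ - (-1 / 2) * Real.sin θ)
      ((s + √3 / 2) * Real.sin θ + (-1 / 2) * Real.cos θ)) ≤ volume.real B := by
  have hi : ∀ z, Integrable fun y => ind B y * ind B (y + z) := fun z =>
    Integrable.of_bound ((measurable_ind hB).mul
      ((measurable_ind hB).comp (measurable_add_const z))).aestronglyMeasurable 1
      (ae_of_all _ fun y => by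
        rw [ind_mul_ind_add]; exact abs_ind_le_one _ _)
  have hi' : ∀ z z', Integrable fun y => ind B y * ind B (y + z) + ind B y * ind B (y + z') :=
    fun z z' => (hi z).add (hi z')
  rw [corr, corr, corr, ← integral_add (hi _) (hi _), ← integral_add (hi' _ _) (hi _),
    ← integral_ind hB]
  have hI : Integrable (ind B) := Integrable.of_bound (measurable_ind hB).aestronglyMeasurable 1
    (ae_of_all _ (abs_ind_le_one B))
  refine integral_mono_ae ((hi' _ _).add (hi _)) hI ?_
  have e12 := h.ae_not_mem (s * Real.cos θ - 0 * Real.sin θ) (s * Real.sin θ + 0 * Real.cos θ)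
    ((s + √3 / 2) * Real.cos θ - 1 / 2 * Real.sin θ)
    ((s + √3 / 2) * Real.sin θ + 1 / 2 * Real.cos θ) (θ + Real.pi / 6)
    (by rw [Real.cos_add, Real.cos_pi_div_six, Real.sin_pi_div_six]; ring)
    (by rw [Real.sin_add, Real.cos_pi_div_six, Real.sin_pi_div_six]; ring)
  have e13 := h.ae_not_mem (s * Real.cos θ - 0 * Real.sin θ) (s * Real.sin θ + 0 * Real.cos θ)
    ((s + √3 / 2) * Real.cos θ - (-1 / 2) * Real.sin θ)
    ((s + √3 / 2) * Real.sin θ + (-1 / 2) * Real.cos θ) (θ - Real.pi / 6)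
    (by rw [Real.cos_sub, Real.cos_pi_div_six, Real.sin_pi_div_six]; ring)
    (by rw [Real.sin_sub, Real.cos_pi_div_six, Real.sin_pi_div_six]; ring)
  have e32 := h.ae_not_mem ((s + √3 / 2) * Real.cos θ - (-1 / 2) * Real.sin θ)
    ((s + √3 / 2) * Real.sin θ + (-1 / 2) * Real.cos θ)
    ((s + √3 / 2) * Real.cos θ - 1 / 2 * Real.sin θ)
    ((s + √3 / 2) * Real.sin θ + 1 / 2 * Real.cos θ) (θ + Real.pi / 2)
    (by rw [Real.cos_add_pi_div_two]; ring) (by rw [Real.sin_add_pi_div_two]; ring)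
  filter_upwards [e12, e13, e32] with y h1 h2 h3
  simp only [← mul_add]
  refine mul_le_of_le_one_right (ind_nonneg B y) ?_
  set a := ind B (y + shift K (s * Real.cos θ - 0 * Real.sin θ) (s * Real.sin θ + 0 * Real.cos θ))
  set b := ind B (y + shift K ((s + √3 / 2) * Real.cos θ - 1 / 2 * Real.sin θ)
      ((s + √3 / 2) * Real.sin θ + 1 / 2 * Real.cos θ))
  set c := ind B (y + shift K ((s + √3 / 2) * Real.cos θ - (-1 / 2) * Real.sin θ)
      ((s + √3 / 2) * Real.sin θ + (-1 / 2) * Real.cos θ))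
  have ha : a ≤ 1 := ind_le_one _ _
  have hb : b ≤ 1 := ind_le_one _ _
  have hc : c ≤ 1 := ind_le_one _ _
  rcases h1 with h1 | h1 <;> rcases h2 with h2 | h2 <;> rcases h3 with h3 | h3 <;> linarith

lemma Avoiding.rotCorr_triangle_le {K : ℝ} {B : Set Torus} (hB : MeasurableSet B)
    (h : Avoiding K B) (s : ℝ) :
    rotCorr K (ind B) s 0 + rotCorr K (ind B) (s + √3 / 2) (1 / 2) +
      rotCorr K (ind B) (s + √3 / 2) (-1 / 2) ≤ volume.real B := by
  have hi := fun x y => intervalIntegrable_corr_rot K (measurable_ind hB) (abs_ind_le_one B) x y 0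
    (2 * Real.pi)
  rw [rotCorr, rotCorr, rotCorr, ← mul_add, ← mul_add, ← intervalIntegral.integral_add (hi _ _)
    (hi _ _), ← intervalIntegral.integral_add ((hi _ _).add (hi _ _)) (hi _ _)]
  have := intervalIntegral.integral_mono_on (by positivity) (((hi s 0).add
    (hi (s + √3 / 2) (1 / 2))).add (hi (s + √3 / 2) (-1 / 2)))
    (intervalIntegrable_const (c := volume.real B)) fun θ _ => h.corr_triangle_le hB s θ
  rw [intervalIntegral.integral_const, smul_eq_mul, sub_zero] at this
  calc _ ≤ 1 / (2 * Real.pi) * (2 * Real.pi * volume.real B) := by gcongr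
    _ = _ := by field_simp

lemma Avoiding.le_rotCorr {K : ℝ} (hK : 0 < K) {B : Set Torus} (hB : MeasurableSet B)
    (h : Avoiding K B) :
    3.9108 * volume.real B ^ 2 - 0.6571 * volume.real B ≤ rotCorr K (ind B) 1.96 0 := by
  have H := fun x y => hasSum_rotCorr hK (measurable_ind hB) (abs_ind_le_one B) x y
  have h0 := hasSum_fourierWeight (measurable_ind hB) (abs_ind_le_one B)
  simp only [ind_sq, integral_ind hB] at h0
  set s : ℝ := 6 / 5 - √3 / 2 with hs
  have h3 : √3 < 1.7320509 := by rw [Real.sqrt_lt' (by norm_num)]; norm_num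
  have h3' : 1.73205 < √3 := by rw [Real.lt_sqrt (by norm_num)]; norm_num
  have hsum : HasSum (fun k => fourierWeight (ind B) k * certificate s (freq K k))
      (rotCorr K (ind B) 1.96 0 + 0.3783 * volume.real B + 2.0575 * rotCorr K (ind B) 1 0 -
        0.3614 * rotCorr K (ind B) 0.94 0 + 0.2788 * (rotCorr K (ind B) s 0 +
          rotCorr K (ind B) (s + √3 / 2) (1 / 2) + rotCorr K (ind B) (s + √3 / 2) (-1 / 2))) := by
    refine HasSum.congr_fun (((((H 1.96 0).add (h0.mul_left 0.3783)).add
      ((H 1 0).mul_left 2.0575)).sub ((H 0.94 0).mul_left 0.3614)).add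
      ((((H s 0).add (H (s + √3 / 2) (1 / 2))).add (H (s + √3 / 2) (-1 / 2))).mul_left 0.2788))
      fun k => ?_
    have q1 : √((s + √3 / 2) ^ 2 + (1 / 2) ^ 2) = 1.3 := by
      rw [Real.sqrt_eq_iff_mul_self_eq (by positivity) (by norm_num), hs]; norm_num
    have q2 : √((s + √3 / 2) ^ 2 + (-1 / 2) ^ 2) = 1.3 := by
      rw [Real.sqrt_eq_iff_mul_self_eq (by positivity) (by norm_num), hs]; norm_num
    have q3 : ∀ x : ℝ, 0 ≤ x → √(x ^ 2 + 0 ^ 2) = x := fun x hx => by simp [Real.sqrt_sq hx]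
    rw [q1, q2, q3 _ (by norm_num), q3 _ (by norm_num), q3 _ (by norm_num),
      q3 _ (by rw [hs]; linarith)]
    simp only [certificate, mul_comm (freq K k)]
    ring_nf
  have hle := le_hasSum hsum 0 fun k _ => mul_nonneg (fourierWeight_nonneg _ k)
    (certificate_nonneg (by rw [abs_le, hs]; constructor <;> linarith)
      (by unfold freq; positivity))
  have hc0 : certificate s (freq K 0) = 3.9108 := by
    simp [certificate, freq, besselZero_zero]; norm_num
  rw [hc0, fourierWeight_zero, integral_ind hB, h.rotCorr_eq_zero hB] at hle
  have ht := h.rotCorr_triangle_le hB s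
  have hp := rotCorr_nonneg K (ind_nonneg B) 0.94 0
  linarith

lemma Avoiding.lt_rotCorr {K : ℝ} (hK : 0 < K) {B : Set Torus} (hB : MeasurableSet B)
    (h : Avoiding K B) (hd : 0.226 ≤ volume.real B) :
    1.003 * volume.real B ^ 2 < rotCorr K (ind B) 1.96 0 := by
  have := h.le_rotCorr hK hB
  nlinarith

/-- The logarithmic moment generating function of a fair coin, up to normalization. -/
noncomputable def softplus (u : ℝ) : ℝ := Real.log (1 + Real.exp u)

lemma continuous_softplus : Continuous softplus :=
  (continuous_const.add Real.continuous_exp).log fun u =>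
    (add_pos one_pos (Real.exp_pos u)).ne'

lemma softplus_nonneg (u : ℝ) : 0 ≤ softplus u :=
  Real.log_nonneg (by linarith [Real.exp_pos u])

lemma monotone_softplus : Monotone softplus := fun u v h =>
  Real.log_le_log (by positivity) (by gcongr)

lemma softplus_le_exp (u : ℝ) : softplus u ≤ Real.exp u := by
  have := Real.log_le_sub_one_of_pos (show 0 < 1 + Real.exp u by positivity)
  unfold softplus; linarith

lemma exp_softplus (u : ℝ) : Real.exp (softplus u) = 1 + Real.exp u :=
  Real.exp_log (by positivity)

lemma softplus_le_quadratic (u : ℝ) : softplus u ≤ Real.log 2 + u / 2 + u ^ 2 / 8 := by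
  rw [softplus, Real.log_le_iff_le_exp (by positivity), Real.exp_add, Real.exp_add,
    Real.exp_log two_pos]
  have h := Real.cosh_le_exp_half_sq (u / 2)
  rw [Real.cosh_eq, show (u / 2) ^ 2 / 2 = u ^ 2 / 8 by ring] at h
  have h1 : Real.exp (u / 2) * Real.exp (u / 2) = Real.exp u := by rw [← Real.exp_add]; ring_nf
  have h2 : Real.exp (u / 2) * Real.exp (-(u / 2)) = 1 := by rw [← Real.exp_add]; simp
  nlinarith [Real.exp_pos (u / 2)]

lemma softplus_tangent (a u : ℝ) :
    softplus a + Real.exp a / (1 + Real.exp a) * (u - a) ≤ softplus u := by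
  set p := Real.exp a / (1 + Real.exp a) with hp
  have hpos : 0 < 1 + Real.exp a := by positivity
  have hp0 : 0 ≤ p := by positivity
  have hp1 : p ≤ 1 := by rw [hp, div_le_one hpos]; linarith
  have hc := convexOn_exp.2 (Set.mem_univ 0) (Set.mem_univ (u - a)) (sub_nonneg.2 hp1) hp0
    (by ring)
  simp only [smul_eq_mul, mul_zero, zero_add, Real.exp_zero, mul_one] at hc
  conv_rhs => rw [softplus]
  rw [Real.le_log_iff_exp_le (by positivity), Real.exp_add, exp_softplus]
  calc _ ≤ (1 + Real.exp a) * (1 - p + p * Real.exp (u - a)) := by gcongr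
    _ = 1 + Real.exp a * Real.exp (u - a) := by rw [hp]; field_simp; ring
    _ = _ := by rw [← Real.exp_add]; ring_nf

/-- A finite family of measurable sets of equal measure which partition the torus, up to null
sets. -/
structure IsCells {ι : Type*} [Fintype ι] (Q : ι → Set Torus) : Prop where
  measurableSet : ∀ v, MeasurableSet (Q v)
  aedisjoint : Pairwise (Function.onFun (AEDisjoint volume) Q)
  measure_eq : ∀ v, volume.real (Q v) = 1 / Fintype.card ι
  nonempty : Nonempty ι

section Cells

variable {ι : Type*} [Fintype ι] {Q : ι → Set Torus}

lemma IsCells.setIntegral_biUnion (hQ : IsCells Q) (S : Finset ι) {g : Torus → ℝ}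
    (hg : Integrable g) : ∫ y in ⋃ v ∈ S, Q v, g y = ∑ v ∈ S, ∫ y in Q v, g y := by
  have := integral_iUnion_ae (μ := volume) (f := g) (s := fun v : S => Q v)
    (fun v => (hQ.measurableSet v).nullMeasurableSet)
    (fun a b h => hQ.aedisjoint fun h' => h (Subtype.ext h')) hg.integrableOn
  rw [tsum_fintype, Finset.sum_coe_sort S fun v => ∫ y in Q v, g y] at this
  rw [← this, Set.iUnion_subtype]

lemma IsCells.card_pos (hQ : IsCells Q) : 0 < (Fintype.card ι : ℝ) := by
  have := hQ.nonempty
  exact_mod_cast Fintype.card_pos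

lemma IsCells.integral_eq_sum (hQ : IsCells Q) {g : Torus → ℝ}
    (hg : Integrable g) : ∫ y, g y = ∑ v, ∫ y in Q v, g y := by
  have hmeas : MeasurableSet (⋃ v ∈ (Finset.univ : Finset ι), Q v) :=
    Finset.measurableSet_biUnion _ fun v _ => hQ.measurableSet v
  rw [← hQ.setIntegral_biUnion Finset.univ hg]
  have h1 : volume.real (⋃ v ∈ (Finset.univ : Finset ι), Q v) = 1 := by
    have := hQ.setIntegral_biUnion Finset.univ (integrable_const (1 : ℝ))
    simp only [integral_const, measureReal_restrict_apply_univ, smul_eq_mul, mul_one,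
      hQ.measure_eq] at this
    rw [this]
    simp [hQ.card_pos.ne']
  have h2 : (⋃ v ∈ (Finset.univ : Finset ι), Q v) =ᵐ[volume] (Set.univ : Set Torus) := by
    rw [ae_eq_univ, ← prob_compl_eq_one_iff hmeas.compl, compl_compl]
    rw [measureReal_def, ENNReal.toReal_eq_one_iff] at h1
    exact h1
  rw [setIntegral_congr_set h2, setIntegral_univ]

lemma integrable_of_abs_le {g : Torus → ℝ} (hg : Measurable g) {L : ℝ} (hL : ∀ y, |g y| ≤ L) :
    Integrable g := Integrable.of_bound hg.aestronglyMeasurable L (ae_of_all _ hL)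

lemma integrable_softplus {g : Torus → ℝ} (hg : Measurable g) {L : ℝ} (hL : ∀ y, |g y| ≤ L) :
    Integrable fun y => softplus (g y) := by
  refine integrable_of_abs_le (continuous_softplus.measurable.comp hg) (L := softplus L) fun y => ?_
  rw [abs_of_nonneg (softplus_nonneg _)]
  exact monotone_softplus ((le_abs_self _).trans (hL y))

lemma IsCells.softplus_average_le (hQ : IsCells Q) {g : Torus → ℝ} (hg : Measurable g) {L : ℝ}
    (hL : ∀ y, |g y| ≤ L) (v : ι) :
    softplus (Fintype.card ι * ∫ y in Q v, g y) ≤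
      Fintype.card ι * ∫ y in Q v, softplus (g y) := by
  set a := Fintype.card ι * ∫ y in Q v, g y with ha
  have hn := hQ.card_pos
  have hgi := integrable_of_abs_le hg hL
  have hga : Integrable fun y => g y - a := hgi.sub (integrable_const a)
  have h : ∫ y in Q v, (softplus a + Real.exp a / (1 + Real.exp a) * (g y - a)) ≤
      ∫ y in Q v, softplus (g y) := by
    refine integral_mono ?_ (integrable_softplus hg hL).integrableOn fun y => softplus_tangent _ _
    exact ((integrable_const _).add (hga.const_mul _)).integrableOn
  rw [integral_add (integrable_const _) (hga.const_mul _).integrableOn,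
    integral_const_mul, integral_sub hgi.integrableOn (integrable_const _), integral_const,
    integral_const, measureReal_restrict_apply_univ, hQ.measure_eq] at h
  simp only [smul_eq_mul] at h
  rw [show (∫ y in Q v, g y) - 1 / Fintype.card ι * a = 0 by rw [ha]; field_simp; ring] at h
  calc softplus a = Fintype.card ι * (1 / Fintype.card ι * softplus a +
      Real.exp a / (1 + Real.exp a) * 0) := by field_simp; ring
    _ ≤ _ := by gcongr

open Classical in
/-- An exponential Markov bound for the number of unions of cells on which `g` has a large
integral. -/
lemma IsCells.card_le_exp (hQ : IsCells Q) {g : Torus → ℝ} (hg : Measurable g) {L : ℝ}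
    (hL : ∀ y, |g y| ≤ L) (c : ℝ) :
    ((Finset.univ.filter fun S : Finset ι => c ≤ ∫ y in ⋃ v ∈ S, Q v, g y).card : ℝ) ≤
      Real.exp (Fintype.card ι * ((∫ y, softplus (g y)) - c)) := by
  set n : ℝ := (Fintype.card ι : ℝ)
  have hn : 0 < n := hQ.card_pos
  have hgi := integrable_of_abs_le hg hL
  have h1 : ((Finset.univ.filter fun S : Finset ι => c ≤ ∫ y in ⋃ v ∈ S, Q v, g y).card : ℝ) ≤
      ∑ S : Finset ι, Real.exp (∑ v ∈ S, n * (∫ y in Q v, g y)) * Real.exp (-(n * c)) := by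
    rw [Finset.card_eq_sum_ones, Finset.sum_filter]
    push_cast
    refine Finset.sum_le_sum fun S _ => ?_
    split_ifs with h
    · rw [← Real.exp_add, ← Finset.mul_sum, ← hQ.setIntegral_biUnion S hgi]
      exact Real.one_le_exp (by nlinarith)
    · positivity
  refine h1.trans ?_
  rw [← Finset.sum_mul]
  simp only [Real.exp_sum]
  rw [← Finset.powerset_univ, ← Finset.prod_one_add]
  simp only [← exp_softplus]
  rw [← Real.exp_sum, ← Real.exp_add, Real.exp_le_exp, mul_sub,
    hQ.integral_eq_sum (integrable_softplus hg hL), Finset.mul_sum, sub_eq_add_neg]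
  gcongr with v _
  exact hQ.softplus_average_le hg hL v

end Cells

/-- The entropy gain: a density `w` supported on a set of measure at most `m` admits a test function
certifying entropy smaller than `m * log 2`, unless `w` is half the indicator function of a set of
measure `m`. -/
lemma exists_entropy_test {w : Torus → ℝ} (hw : Measurable w) (h0 : ∀ y, 0 ≤ w y)
    (h1 : ∀ y, w y ≤ 1) {m : ℝ} (hm : volume.real {y | 0 < w y} ≤ m)
    (hne : ¬ (volume.real {y | 0 < w y} = m ∧ ∀ᵐ y, w y = 1 / 2 * ind {y | 0 < w y} y)) :
    ∃ (g : Torus → ℝ) (L η : ℝ), Measurable g ∧ (∀ y, |g y| ≤ L) ∧ 0 < η ∧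
      (∫ y, softplus (g y)) - ∫ y, w y * g y ≤ m * Real.log 2 - η := by
  set B := {y | 0 < w y} with hBdef
  have hB : MeasurableSet B := measurableSet_lt measurable_const hw
  set D := ∫ y in B, (w y - 1 / 2) ^ 2 with hD
  have hD0 : 0 ≤ D := integral_nonneg fun y => sq_nonneg _
  have hDi : Integrable (fun y => (w y - 1 / 2) ^ 2) :=
    integrable_of_abs_le (by fun_prop) (L := 1) fun y => by
      rw [abs_of_nonneg (sq_nonneg _)]; nlinarith [h0 y, h1 y]
  have hlog : 0 < Real.log 2 := Real.log_pos one_lt_two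
  have hκ : 0 < (m - volume.real B) * Real.log 2 + 2 * D := by
    rcases hm.lt_or_eq with h | h
    · have := mul_pos (sub_pos.2 h) hlog; linarith
    · have : D ≠ 0 := by
        intro hDz
        refine hne ⟨h, ?_⟩
        rw [hD, setIntegral_eq_zero_iff_of_nonneg_ae (ae_of_all _ fun y => sq_nonneg _)
          hDi.integrableOn, EventuallyEq, ae_restrict_iff' hB] at hDz
        filter_upwards [hDz] with y hy
        by_cases hyB : y ∈ B
        · have := hy hyB
          simp only [Pi.zero_apply, ne_eq, OfNat.ofNat_ne_zero, not_false_eq_true,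
            pow_eq_zero_iff] at this
          simp only [ind, hyB, Set.indicator_of_mem]; linarith
        · have : w y = 0 := le_antisymm (not_lt.1 hyB) (h0 y)
          simp [ind, hyB, this]
      rw [h]; have := hD0.lt_of_ne' this; linarith
  set κ := (m - volume.real B) * Real.log 2 + 2 * D with hκd
  set L := max 2 (-Real.log (κ / 2)) with hL
  have hexpL : Real.exp (-L) ≤ κ / 2 := by
    rw [← Real.le_log_iff_exp_le (by positivity)]
    have := le_max_right 2 (-Real.log (κ / 2)); linarith
  have hL2 : 2 ≤ L := le_max_left _ _
  classical
  set g : Torus → ℝ := B.piecewise (fun y => 4 * (w y - 1 / 2)) fun _ => -L with hg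
  have hgm : Measurable g := Measurable.piecewise hB (by fun_prop) measurable_const
  have hgL : ∀ y, |g y| ≤ L := fun y => by
    by_cases hy : y ∈ B
    · simp only [hg, hy, Set.piecewise_eq_of_mem]
      rw [abs_le]; constructor <;> linarith [h0 y, h1 y]
    · simp only [hg, hy, not_false_eq_true, Set.piecewise_eq_of_notMem]
      rw [abs_neg, abs_of_nonneg]; linarith
  have hwg : Integrable fun y => w y * g y := integrable_of_abs_le (by fun_prop) (L := L) fun y => by
    rw [abs_mul, abs_of_nonneg (h0 y)]
    nlinarith [h0 y, h1 y, hgL y, abs_nonneg (g y)]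
  refine ⟨g, L, κ / 2, hgm, hgL, by positivity, ?_⟩
  rw [← integral_sub (integrable_softplus hgm hgL) hwg]
  have hpt : ∀ y, softplus (g y) - w y * g y ≤
      B.indicator (fun y => Real.log 2 - 2 * (w y - 1 / 2) ^ 2) y + Real.exp (-L) := by
    intro y
    by_cases hy : y ∈ B
    · simp only [hg, hy, Set.piecewise_eq_of_mem, Set.indicator_of_mem]
      have := softplus_le_quadratic (4 * (w y - 1 / 2))
      nlinarith [Real.exp_pos (-L)]
    · have hz : w y = 0 := le_antisymm (not_lt.1 hy) (h0 y)
      simp only [hg, hy, not_false_eq_true, Set.piecewise_eq_of_notMem,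
        Set.indicator_of_notMem, hz]
      linarith [softplus_le_exp (-L)]
  have hi : Integrable fun y => Real.log 2 - 2 * (w y - 1 / 2) ^ 2 :=
    (integrable_const _).sub (hDi.const_mul 2)
  calc _ ≤ ∫ y, (B.indicator (fun y => Real.log 2 - 2 * (w y - 1 / 2) ^ 2) y + Real.exp (-L)) :=
        integral_mono ((integrable_softplus hgm hgL).sub hwg)
          ((hi.indicator hB).add (integrable_const _)) hpt
    _ = volume.real B * Real.log 2 - 2 * D + Real.exp (-L) := by
        rw [integral_add (hi.indicator hB) (integrable_const _), integral_indicator hB,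
          integral_sub (integrable_const _) (hDi.const_mul 2).integrableOn, integral_const_mul]
        simp [hD]
    _ ≤ _ := by rw [hκd] at hexpL ⊢; linarith

open Classical in
/-- The class in `L²` of a function on the torus (zero if it is not square integrable). -/
noncomputable def testLp (g : Torus → ℝ) : Lp ℝ 2 (volume : Measure Torus) :=
  if h : MemLp g 2 volume then h.toLp else 0

lemma memLp_of_abs_le {g : Torus → ℝ} (hg : Measurable g) {L : ℝ} (hL : ∀ y, |g y| ≤ L) :
    MemLp g 2 volume := MemLp.of_bound hg.aestronglyMeasurable L (ae_of_all _ hL)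

lemma coeFn_testLp {g : Torus → ℝ} (hg : MemLp g 2 volume) : testLp g =ᵐ[volume] g := by
  rw [testLp, dif_pos hg]; exact hg.coeFn_toLp

/-- Integration against `w`, as an element of the weak dual of `L²`. -/
noncomputable def pairing (w : Torus → ℝ) : WeakDual ℝ (Lp ℝ 2 (volume : Measure Torus)) :=
  StrongDual.toWeakDual (InnerProductSpace.toDual ℝ _ (testLp w))

lemma inner_testLp {f : Lp ℝ 2 (volume : Measure Torus)} {w g : Torus → ℝ} (hf : f =ᵐ[volume] w)
    (hg : MemLp g 2 volume) : inner ℝ f (testLp g) = ∫ y, w y * g y := by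
  rw [L2.inner_def]
  refine integral_congr_ae ?_
  filter_upwards [hf, coeFn_testLp hg] with y h1 h2
  rw [h1, h2]; simp [mul_comm]

lemma pairing_apply {w g : Torus → ℝ} (hw : MemLp w 2 volume) (hg : MemLp g 2 volume) :
    pairing w (testLp g) = ∫ y, w y * g y := inner_testLp (coeFn_testLp hw) hg

lemma memLp_ind {s : Set Torus} (hs : MeasurableSet s) : MemLp (ind s) 2 volume :=
  memLp_of_abs_le (measurable_ind hs) (abs_ind_le_one s)

/-- The functionals represented by functions with values in `[0, 1]`. -/
def densities : Set (WeakDual ℝ (Lp ℝ 2 (volume : Measure Torus))) :=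
  WeakDual.toStrongDual ⁻¹' Metric.closedBall 0 1 ∩
    ⋂ s : {s : Set Torus // MeasurableSet s},
      {φ | φ (testLp (ind s)) ∈ Set.Icc 0 (volume.real s.1)}

lemma isCompact_densities : IsCompact densities :=
  (WeakDual.isCompact_closedBall 0 1).inter_right <| isClosed_iInter fun _ =>
    isClosed_Icc.preimage (WeakDual.eval_continuous _)

lemma integral_mul_ind (w : Torus → ℝ) {s : Set Torus} (hs : MeasurableSet s) :
    ∫ y, w y * ind s y = ∫ y in s, w y := by
  rw [← integral_indicator hs]
  congr 1; ext y
  by_cases h : y ∈ s <;> simp [ind, h]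

lemma exists_density {φ : WeakDual ℝ (Lp ℝ 2 (volume : Measure Torus))} (hφ : φ ∈ densities) :
    ∃ w : Torus → ℝ, Measurable w ∧ (∀ y, 0 ≤ w y) ∧ (∀ y, w y ≤ 1) ∧
      ∀ g, MemLp g 2 volume → φ (testLp g) = ∫ y, w y * g y := by
  set f := (InnerProductSpace.toDual ℝ (Lp ℝ 2 (volume : Measure Torus))).symm
    (WeakDual.toStrongDual φ) with hf
  have hφf : ∀ g, MemLp g 2 volume → φ (testLp g) = ∫ y, f y * g y := fun g hg => by
    rw [← inner_testLp (ae_eq_refl _) hg, hf, InnerProductSpace.toDual_symm_apply]; rfl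
  have hfi : Integrable f := (Lp.memLp f).integrable one_le_two
  have hs := Set.mem_iInter.1 hφ.2
  have h0 : 0 ≤ᵐ[volume] f := ae_nonneg_of_forall_setIntegral_nonneg hfi fun s hsm _ => by
    have := (hs ⟨s, hsm⟩).1
    rwa [hφf _ (memLp_ind hsm), integral_mul_ind _ hsm] at this
  have h1 : f ≤ᵐ[volume] fun _ => (1 : ℝ) :=
    ae_le_of_forall_setIntegral_le hfi (integrable_const 1) fun s hsm _ => by
      have := (hs ⟨s, hsm⟩).2
      rw [hφf _ (memLp_ind hsm), integral_mul_ind _ hsm] at this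
      simpa using this
  refine ⟨fun y => max 0 (min 1 (f y)), measurable_const.max (measurable_const.min
    (Lp.stronglyMeasurable f).measurable), fun y => le_max_left _ _, fun y =>
    max_le zero_le_one (min_le_left _ _), fun g hg => ?_⟩
  rw [hφf g hg]
  refine integral_congr_ae ?_
  filter_upwards [h0, h1] with y h0 h1
  rw [min_eq_right h1, max_eq_right (show (0 : ℝ) ≤ f y from h0)]

lemma pairing_ind_mem_densities {A : Set Torus} (hA : MeasurableSet A) :
    pairing (ind A) ∈ densities := by
  constructor
  · simp only [Set.mem_preimage, mem_closedBall_zero_iff]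
    change ‖InnerProductSpace.toDual ℝ _ (testLp (ind A))‖ ≤ 1
    rw [LinearIsometryEquiv.norm_map, ← abs_of_nonneg (norm_nonneg _), ← sq_le_one_iff_abs_le_one,
      ← real_inner_self_eq_norm_sq, inner_testLp (coeFn_testLp (memLp_ind hA)) (memLp_ind hA)]
    simp only [← sq, ind_sq, integral_ind hA]
    exact measureReal_le_one
  · refine Set.mem_iInter.2 fun ⟨s, hs⟩ => ?_
    simp only [Set.mem_ofPred_eq, pairing_apply (memLp_ind hA) (memLp_ind hs)]
    refine ⟨integral_nonneg fun y => mul_nonneg (ind_nonneg _ _) (ind_nonneg _ _), ?_⟩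
    rw [← integral_ind hs]
    refine integral_mono_of_nonneg (ae_of_all _ fun y => mul_nonneg (ind_nonneg _ _)
      (ind_nonneg _ _)) (integrable_of_abs_le (measurable_ind hs) (abs_ind_le_one s))
      (ae_of_all _ fun y => mul_le_of_le_one_left (ind_nonneg _ _) (ind_le_one _ _))

/-- The squared modulus of the `k`-th Fourier coefficient of a functional. -/
noncomputable def dualWeight (φ : WeakDual ℝ (Lp ℝ 2 (volume : Measure Torus)))
    (k : Fin 2 → ℤ) : ℝ :=
  φ (testLp fun y => (UnitAddTorus.mFourier k y).re) ^ 2 +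
    φ (testLp fun y => (UnitAddTorus.mFourier k y).im) ^ 2

/-- The extension of `rotCorr` to functionals. -/
noncomputable def dualCorr (K r : ℝ) (φ : WeakDual ℝ (Lp ℝ 2 (volume : Measure Torus))) : ℝ :=
  ∑' k, dualWeight φ k * besselZero (freq K k * r)

lemma continuous_dualWeight (k : Fin 2 → ℤ) : Continuous fun φ => dualWeight φ k :=
  ((WeakDual.eval_continuous _).pow 2).add ((WeakDual.eval_continuous _).pow 2)

lemma dualWeight_eq {φ : WeakDual ℝ (Lp ℝ 2 (volume : Measure Torus))} {w : Torus → ℝ}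
    (h : ∀ g, MemLp g 2 volume → φ (testLp g) = ∫ y, w y * g y) (k : Fin 2 → ℤ) :
    dualWeight φ k = fourierWeight w k := by
  rw [dualWeight, fourierWeight, h, h]
  · exact memLp_of_abs_le (Complex.continuous_im.comp (map_continuous _)).measurable (L := 1)
      fun y => (Complex.abs_im_le_norm _).trans (norm_mFourier_apply k y).le
  · exact memLp_of_abs_le (Complex.continuous_re.comp (map_continuous _)).measurable (L := 1)
      fun y => (Complex.abs_re_le_norm _).trans (norm_mFourier_apply k y).le

lemma dualCorr_eq {K r : ℝ} (hK : 0 < K) (hr : 0 ≤ r)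
    {φ : WeakDual ℝ (Lp ℝ 2 (volume : Measure Torus))} {w : Torus → ℝ} (hw : Measurable w)
    (hb : ∀ y, |w y| ≤ 1) (h : ∀ g, MemLp g 2 volume → φ (testLp g) = ∫ y, w y * g y) :
    dualCorr K r φ = rotCorr K w r 0 := by
  have := (hasSum_rotCorr hK hw hb r 0).tsum_eq
  rw [← this, dualCorr]
  simp only [dualWeight_eq h]
  congr! 4
  rw [zero_pow two_ne_zero, add_zero, Real.sqrt_sq hr]

lemma finite_freq_lt {K : ℝ} (hK : 0 < K) (M : ℝ) : {k : Fin 2 → ℤ | freq K k < M}.Finite := by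
  set R := ⌈M * K / (2 * Real.pi)⌉ with hR
  refine (Set.finite_Icc (fun _ => -R : Fin 2 → ℤ) (fun _ => R)).subset fun k hk => ?_
  have hk' : √((k 0 : ℝ) ^ 2 + (k 1 : ℝ) ^ 2) ≤ R := by
    refine le_trans ?_ (Int.le_ceil _)
    simp only [freq, Set.mem_ofPred_eq] at hk
    rw [le_div_iff₀ (by positivity)]
    calc _ = 2 * Real.pi / K * √((k 0 : ℝ) ^ 2 + (k 1 : ℝ) ^ 2) * K := by field_simp
      _ ≤ M * K := by gcongr
  have h0 : |(k 0 : ℝ)| ≤ R := (Real.abs_le_sqrt (by nlinarith [sq_nonneg (k 1 : ℝ)])).trans hk'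
  have h1 : |(k 1 : ℝ)| ≤ R := (Real.abs_le_sqrt (by nlinarith [sq_nonneg (k 0 : ℝ)])).trans hk'
  rw [abs_le] at h0 h1
  have h0' : -R ≤ k 0 ∧ k 0 ≤ R := by exact_mod_cast h0
  have h1' : -R ≤ k 1 ∧ k 1 ≤ R := by exact_mod_cast h1
  refine ⟨fun i => ?_, fun i => ?_⟩ <;> fin_cases i
  exacts [h0'.1, h1'.1, h0'.2, h1'.2]

lemma finite_lt_abs_besselZero {K r : ℝ} (hK : 0 < K) (hr : 0 < r) {ε : ℝ} (hε : 0 < ε) :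
    {k : Fin 2 → ℤ | ε < |besselZero (freq K k * r)|}.Finite := by
  refine (finite_freq_lt hK (max (12 / 5) (1 / ε ^ 2) / r)).subset fun k hk => ?_
  by_contra hc
  simp only [Set.mem_ofPred_eq, not_lt, div_le_iff₀ hr] at hc hk
  have h1 := mul_besselZero_sq_le_of_le ((le_max_left _ _).trans hc)
  have h2 : 1 ≤ freq K k * r * ε ^ 2 := by
    have := (le_max_right _ _).trans hc
    rwa [div_le_iff₀ (by positivity)] at this
  have h3 : ε ^ 2 ≤ besselZero (freq K k * r) ^ 2 := by
    rw [← sq_abs (besselZero _)]; gcongr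
  have : 0 ≤ freq K k * r := le_trans (by positivity) ((le_max_left _ _).trans hc)
  nlinarith

lemma continuousOn_dualCorr {K r : ℝ} (hK : 0 < K) (hr : 0 < r) :
    ContinuousOn (dualCorr K r) densities := by
  refine continuousOn_of_uniform_approx_of_continuousOn fun u hu => ?_
  obtain ⟨ε, hε, hεu⟩ := Metric.mem_uniformity_dist.1 hu
  set F := (finite_lt_abs_besselZero hK hr (half_pos hε)).toFinset with hF
  refine ⟨fun φ => ∑ k ∈ F, dualWeight φ k * besselZero (freq K k * r),
    (continuous_finsetSum _ fun k _ =>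
      (continuous_dualWeight k).mul continuous_const).continuousOn, fun φ hφ => hεu ?_⟩
  obtain ⟨w, hw, h0, h1, h⟩ := exists_density hφ
  have hb : ∀ y, |w y| ≤ 1 := fun y => abs_le.2 ⟨by linarith [h0 y], h1 y⟩
  have hs := hasSum_fourierWeight hw hb
  have hsum : Summable fun k => dualWeight φ k * besselZero (freq K k * r) := by
    simp only [dualWeight_eq h]
    refine Summable.of_norm_bounded hs.summable fun k => ?_
    rw [norm_mul, Real.norm_of_nonneg (fourierWeight_nonneg _ _)]
    exact mul_le_of_le_one_right (fourierWeight_nonneg _ _) (abs_besselZero_le_one _)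
  rw [dualCorr, ← hsum.sum_add_tsum_compl (s := F), Real.dist_eq, add_sub_cancel_left]
  have hle : ∀ k : ↑(↑F : Set (Fin 2 → ℤ))ᶜ, ‖dualWeight φ k * besselZero (freq K k * r)‖ ≤
      fourierWeight w k * (ε / 2) := by
    rintro ⟨k, hk⟩
    rw [norm_mul, dualWeight_eq h, Real.norm_of_nonneg (fourierWeight_nonneg _ _)]
    refine mul_le_mul_of_nonneg_left ?_ (fourierWeight_nonneg _ _)
    simpa [hF] using hk
  have hsw := hs.summable.subtype ((F : Set (Fin 2 → ℤ))ᶜ)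
  calc _ ≤ ∑' k : ↑(↑F : Set (Fin 2 → ℤ))ᶜ, fourierWeight w k * (ε / 2) :=
        tsum_of_norm_bounded (hsw.mul_right (ε / 2)).hasSum hle
    _ = (∑' k : ↑(↑F : Set (Fin 2 → ℤ))ᶜ, fourierWeight w k) * (ε / 2) := tsum_mul_right
    _ ≤ 1 * (ε / 2) := by
        gcongr
        calc _ ≤ ∑' k, fourierWeight w k :=
              Summable.tsum_subtype_le _ _ (fourierWeight_nonneg w) hs.summable
          _ = ∫ y, w y ^ 2 := hs.tsum_eq
          _ ≤ ∫ y : Torus, (1 : ℝ) := integral_mono (integrable_of_abs_le (by fun_prop) (L := 1)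
              fun y => by rw [abs_of_nonneg (sq_nonneg _)]; nlinarith [h0 y, h1 y])
              (integrable_const 1) fun y => by
                show w y ^ 2 ≤ 1
                nlinarith [h0 y, h1 y]
          _ = 1 := by simp
    _ < ε := by linarith

lemma shift_periodic (K : ℝ) :
    Function.Periodic (fun θ => shift K (Real.cos θ) (Real.sin θ)) (2 * Real.pi) := fun θ => by
  simp

lemma corr_eq_zero_of_rotCorr {K : ℝ} {w : Torus → ℝ} (hw : Measurable w) (h0 : ∀ y, 0 ≤ w y)
    (h1 : ∀ y, w y ≤ 1) (h : rotCorr K w 1 0 = 0) (θ : ℝ) :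
    corr w (shift K (Real.cos θ) (Real.sin θ)) = 0 := by
  have hb : ∀ y, |w y| ≤ 1 := fun y => abs_le.2 ⟨by linarith [h0 y], h1 y⟩
  have hc : Continuous fun θ => corr w (shift K (Real.cos θ) (Real.sin θ)) :=
    (continuous_corr hw hb).comp (continuous_shift K Real.continuous_cos Real.continuous_sin)
  simp only [rotCorr, one_mul, zero_mul, sub_zero, add_zero, mul_eq_zero, one_div, inv_eq_zero,
    Real.pi_ne_zero, OfNat.ofNat_ne_zero, or_self, false_or] at h
  rw [intervalIntegral.integral_eq_zero_iff_of_le_of_nonneg_ae (by positivity)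
    (ae_of_all _ fun θ => corr_nonneg h0 _) (hc.intervalIntegrable _ _)] at h
  have heq := Measure.eqOn_Ioc_of_ae_eq volume h hc.continuousOn continuousOn_const
  obtain ⟨t, ht, htθ⟩ := (shift_periodic K).exists_mem_Ioc Real.two_pi_pos θ 0
  rw [zero_add] at ht
  have := heq ht
  simp only [Pi.zero_apply] at this htθ
  rw [htθ, this]

lemma avoiding_support {K : ℝ} {w : Torus → ℝ} (hw : Measurable w) (h0 : ∀ y, 0 ≤ w y)
    (h1 : ∀ y, w y ≤ 1) (h : rotCorr K w 1 0 = 0) : Avoiding K {y | 0 < w y} := fun θ => by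
  have hc := corr_eq_zero_of_rotCorr hw h0 h1 h θ
  have hi : Integrable fun y => w y * w (y + shift K (Real.cos θ) (Real.sin θ)) :=
    integrable_of_abs_le (hw.mul (hw.comp (measurable_add_const _))) (L := 1) fun y => by
      rw [abs_of_nonneg (mul_nonneg (h0 _) (h0 _))]
      exact mul_le_one₀ (h1 _) (h0 _) (h1 _)
  rw [corr, integral_eq_zero_iff_of_nonneg (fun y => mul_nonneg (h0 _) (h0 _)) hi] at hc
  refine measure_mono_null (fun y hy => ?_) (ae_iff.1 hc)
  exact (mul_pos hy.1 hy.2).ne'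

lemma rotCorr_const_mul (K c : ℝ) {w v : Torus → ℝ} (h : ∀ᵐ y, w y = c * v y) (x y : ℝ) :
    rotCorr K w x y = c ^ 2 * rotCorr K v x y := by
  have : ∀ z, corr w z = c ^ 2 * corr v z := fun z => by
    rw [corr, corr, ← integral_const_mul]
    refine integral_congr_ae ?_
    filter_upwards [h, (measurePreserving_add_right volume z).quasiMeasurePreserving.ae h]
      with y h1 h2
    rw [h1, h2]; ring
  simp only [rotCorr, this, intervalIntegral.integral_const_mul]
  ring

open Classical in
/-- The collections of cells whose union avoids unit distances but is not clustered. -/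
noncomputable def badSets (K : ℝ) {ι : Type} [Fintype ι] (Q : ι → Set Torus) :
    Finset (Finset ι) :=
  Finset.univ.filter fun S => rotCorr K (ind (⋃ v ∈ S, Q v)) 1 0 = 0 ∧
    rotCorr K (ind (⋃ v ∈ S, Q v)) 1.96 0 ≤ 1.001 * volume.real (⋃ v ∈ S, Q v) ^ 2

lemma IsCells.measurableSet_biUnion {ι : Type*} [Fintype ι] {Q : ι → Set Torus} (hQ : IsCells Q)
    (S : Finset ι) : MeasurableSet (⋃ v ∈ S, Q v) :=
  Finset.measurableSet_biUnion _ fun v _ => hQ.measurableSet v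

open Classical in
lemma exists_nhds_card_badSets_le {K : ℝ} (hK : 0 < K) {m : ℝ}
    (hm : ∀ B, MeasurableSet B → Avoiding K B → volume.real B ≤ m)
    (hext : ∀ B, MeasurableSet B → Avoiding K B → volume.real B = m →
      1.001 * m ^ 2 < rotCorr K (ind B) 1.96 0)
    {φ : WeakDual ℝ (Lp ℝ 2 (volume : Measure Torus))} (hφ : φ ∈ densities) :
    ∃ t ∈ nhdsWithin φ densities, ∃ C η : ℝ, 0 < η ∧ ∀ (ι : Type) [Fintype ι] (Q : ι → Set Torus),
      IsCells Q →
      (((badSets K Q).filter fun S => pairing (ind (⋃ v ∈ S, Q v)) ∈ t).card : ℝ) ≤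
        C * Real.exp (Fintype.card ι * (m * Real.log 2 - η)) := by
  have hcorr : ∀ (ι : Type) [Fintype ι] (Q : ι → Set Torus), IsCells Q → ∀ (S : Finset ι) (r : ℝ),
      0 ≤ r → dualCorr K r (pairing (ind (⋃ v ∈ S, Q v))) = rotCorr K (ind (⋃ v ∈ S, Q v)) r 0 :=
    fun ι _ Q hQ S r hr => dualCorr_eq hK hr (measurable_ind (hQ.measurableSet_biUnion S))
      (abs_ind_le_one _) fun g hg => pairing_apply (memLp_ind (hQ.measurableSet_biUnion S)) hg
  have h1Lp : MemLp (fun _ : Torus => (1 : ℝ)) 2 volume := memLp_const 1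
  have hnone : ∀ t : Set (WeakDual ℝ (Lp ℝ 2 (volume : Measure Torus))),
      (∀ (ι : Type) [Fintype ι] (Q : ι → Set Torus), IsCells Q → ∀ S ∈ badSets K Q,
        pairing (ind (⋃ v ∈ S, Q v)) ∉ t) → ∃ C η : ℝ, 0 < η ∧
      ∀ (ι : Type) [Fintype ι] (Q : ι → Set Torus), IsCells Q →
      (((badSets K Q).filter fun S => pairing (ind (⋃ v ∈ S, Q v)) ∈ t).card : ℝ) ≤
        C * Real.exp (Fintype.card ι * (m * Real.log 2 - η)) := fun t ht =>
    ⟨0, 1, one_pos, fun ι _ Q hQ => by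
      rw [Finset.filter_false_of_mem (ht ι Q hQ)]; simp⟩
  by_cases hc1 : dualCorr K 1 φ = 0
  swap
  · refine ⟨_, (continuousOn_dualCorr hK one_pos φ hφ).preimage_mem_nhdsWithin
      (isOpen_ne.mem_nhds hc1), hnone _ fun ι _ Q hQ S hS hmem => hmem ?_⟩
    rw [hcorr ι Q hQ S 1 zero_le_one]
    exact (Finset.mem_filter.1 hS).2.1
  by_cases hc2 : 1.001 * φ (testLp fun _ => 1) ^ 2 < dualCorr K 1.96 φ
  · refine ⟨{ψ | 1.001 * ψ (testLp fun _ => 1) ^ 2 < dualCorr K 1.96 ψ}, ?_,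
      hnone _ fun ι _ Q hQ S hS hmem => ?_⟩
    · exact (((continuous_const.mul ((WeakDual.eval_continuous _).pow 2)).continuousWithinAt
        ).tendsto).eventually_lt (continuousOn_dualCorr hK (by norm_num) φ hφ) hc2
    · have hA := hQ.measurableSet_biUnion S
      rw [Set.mem_ofPred_eq, hcorr ι Q hQ S 1.96 (by norm_num),
        pairing_apply (memLp_ind hA) h1Lp] at hmem
      simp only [mul_one, integral_ind hA] at hmem
      exact absurd (Finset.mem_filter.1 hS).2.2 (not_le.2 hmem)
  obtain ⟨w, hw, h0, h1, h⟩ := exists_density hφ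
  have hb : ∀ y, |w y| ≤ 1 := fun y => abs_le.2 ⟨by linarith [h0 y], h1 y⟩
  rw [dualCorr_eq hK zero_le_one hw hb h] at hc1
  rw [dualCorr_eq hK (by norm_num) hw hb h, h _ h1Lp] at hc2
  simp only [mul_one] at hc2
  have hBm : MeasurableSet {y | 0 < w y} := measurableSet_lt measurable_const hw
  have hBa := avoiding_support hw h0 h1 hc1
  obtain ⟨g, L, η, hg, hgL, hη, hle⟩ := exists_entropy_test hw h0 h1 (hm _ hBm hBa) (by
    rintro ⟨hv, hae⟩
    refine hc2 ?_
    have hlt := hext _ hBm hBa hv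
    rw [rotCorr_const_mul K _ hae, integral_congr_ae hae, integral_const_mul, integral_ind hBm, hv]
    linarith)
  have hgLp : MemLp g 2 volume := memLp_of_abs_le hg hgL
  refine ⟨{ψ | φ (testLp g) - η / 2 < ψ (testLp g)}, mem_nhdsWithin_of_mem_nhds
    ((isOpen_lt continuous_const (WeakDual.eval_continuous _)).mem_nhds (by
      simp only [Set.mem_ofPred_eq]; linarith)), 1, η / 2, half_pos hη, fun ι _ Q hQ => ?_⟩
  have hcard := hQ.card_le_exp hg hgL ((∫ y, w y * g y) - η / 2)
  refine le_trans ?_ (hcard.trans ?_)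
  · norm_cast
    refine Finset.card_le_card fun S hS => ?_
    have hA := hQ.measurableSet_biUnion S
    have := (Finset.mem_filter.1 hS).2
    rw [Set.mem_ofPred_eq, h _ hgLp, pairing_apply (memLp_ind hA) hgLp] at this
    simp only [mul_comm (ind _ _), integral_mul_ind _ hA] at this
    exact Finset.mem_filter.2 ⟨Finset.mem_univ _, this.le⟩
  · rw [one_mul, Real.exp_le_exp]
    have := hQ.card_pos
    exact mul_le_mul_of_nonneg_left (by linarith) this.le

open Classical in
/-- If the avoiding sets of maximal density are clustered, then the avoiding unions of cells which
are not clustered are exponentially fewer than `2 ^ (m n)`. -/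
lemma card_badSets_le {K : ℝ} (hK : 0 < K) {m : ℝ}
    (hm : ∀ B, MeasurableSet B → Avoiding K B → volume.real B ≤ m)
    (hext : ∀ B, MeasurableSet B → Avoiding K B → volume.real B = m →
      1.001 * m ^ 2 < rotCorr K (ind B) 1.96 0) :
    ∃ C η : ℝ, 0 < η ∧ ∀ (ι : Type) [Fintype ι] (Q : ι → Set Torus), IsCells Q →
      ((badSets K Q).card : ℝ) ≤ C * Real.exp (Fintype.card ι * (m * Real.log 2 - η)) := by
  have key := isCompact_densities.induction_on (p := fun t => ∃ C η : ℝ, 0 < η ∧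
      ∀ (ι : Type) [Fintype ι] (Q : ι → Set Torus), IsCells Q →
      (((badSets K Q).filter fun S => pairing (ind (⋃ v ∈ S, Q v)) ∈ t).card : ℝ) ≤
        C * Real.exp (Fintype.card ι * (m * Real.log 2 - η)))
    ⟨0, 1, one_pos, fun ι _ Q hQ => by simp⟩
    (fun s t hst ⟨C, η, hη, h⟩ => ⟨C, η, hη, fun ι _ Q hQ => le_trans (by
      norm_cast
      exact Finset.card_le_card (Finset.monotone_filter_right _ fun S _ hS => hst hS)) (h ι Q hQ)⟩)
    (by
      rintro s t ⟨C, η, hη, h⟩ ⟨C', η', hη', h'⟩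
      refine ⟨max C 0 + max C' 0, min η η', lt_min hη hη', fun ι _ Q hQ => ?_⟩
      have hn := hQ.card_pos
      calc _ ≤ (((badSets K Q).filter fun S => pairing (ind (⋃ v ∈ S, Q v)) ∈ s).card : ℝ) +
            (((badSets K Q).filter fun S => pairing (ind (⋃ v ∈ S, Q v)) ∈ t).card : ℝ) := by
            norm_cast
            refine le_trans (Finset.card_le_card ?_) (Finset.card_union_le _ _)
            intro S hS
            simp only [Finset.mem_union, Finset.mem_filter, Set.mem_union] at hS ⊢
            tauto
        _ ≤ max C 0 * Real.exp (Fintype.card ι * (m * Real.log 2 - η)) +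
            max C' 0 * Real.exp (Fintype.card ι * (m * Real.log 2 - η')) := by
            refine add_le_add ((h ι Q hQ).trans ?_) ((h' ι Q hQ).trans ?_)
            · gcongr; exact le_max_left _ _
            · gcongr; exact le_max_left _ _
        _ ≤ _ := by
            rw [add_mul]
            gcongr
            · exact min_le_left _ _
            · exact min_le_right _ _)
    fun φ hφ => exists_nhds_card_badSets_le hK hm hext hφ
  obtain ⟨C, η, hη, h⟩ := key
  refine ⟨C, η, hη, fun ι _ Q hQ => ?_⟩
  have := h ι Q hQ
  rwa [Finset.filter_true_of_mem fun S _ =>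
    pairing_ind_mem_densities (hQ.measurableSet_biUnion S)] at this

lemma exists_isCompact_avoiding {K : ℝ} {B : Set Torus} (hB : MeasurableSet B)
    (h : Avoiding K B) {η : ℝ} (hη : 0 < η) : ∃ F : Set Torus, IsCompact F ∧
      volume.real B - η < volume.real F ∧
      ∀ θ, ∀ y ∈ F, y + shift K (Real.cos θ) (Real.sin θ) ∉ F := by
  set D : Torus → Prop := fun x => Tendsto (fun r : ℝ => volume (B ∩ Metric.closedBall x r) /
    volume (Metric.closedBall x r)) (nhdsWithin 0 (Set.Ioi 0)) (nhds 1) with hD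
  have hae : ∀ᵐ x : Torus, x ∈ B → D x := by
    rw [← ae_restrict_iff' hB]
    filter_upwards [IsUnifLocDoublingMeasure.ae_tendsto_measure_inter_div
      (volume : Measure Torus) B 1] with x hx
    refine hx (fun _ => x) id tendsto_id ?_
    filter_upwards [self_mem_nhdsWithin] with r (hr : 0 < r)
    simpa using hr.le
  set Z := toMeasurable volume {x : Torus | ¬ (x ∈ B → D x)}
  have hZ : volume Z = 0 := by rw [measure_toMeasurable]; exact hae
  have hBZ : volume (B \ Z) = volume B := measure_sdiff_null hZ
  have key : ∀ F, F ⊆ B \ Z → ∀ θ, ∀ y ∈ F, y + shift K (Real.cos θ) (Real.sin θ) ∉ F := by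
    intro F hF θ y hy hye
    set e := shift K (Real.cos θ) (Real.sin θ)
    have hd : ∀ x ∈ F, D x := fun x hx => by
      by_contra hc
      exact (hF hx).2 (subset_toMeasurable _ _ fun hh => hc (hh (hF hx).1))
    have hhalf : (1 / 2 : ℝ≥0∞) < 1 := by
      rw [one_div]; exact ENNReal.inv_lt_one.2 (by norm_num)
    obtain ⟨r, ⟨h1, h2⟩, hr⟩ := (((hd y hy).eventually (lt_mem_nhds hhalf)).and
      ((hd _ hye).eventually (lt_mem_nhds hhalf)) |>.and self_mem_nhdsWithin).exists
    have hpos : volume (Metric.closedBall y r) ≠ 0 := (Metric.measure_closedBall_pos _ _ hr).ne'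
    have hpre : (fun x => x + e) ⁻¹' (B ∩ Metric.closedBall (y + e) r) =
        (fun x => x + e) ⁻¹' B ∩ Metric.closedBall y r := by
      ext x; simp
    have hv : volume (Metric.closedBall (y + e) r) = volume (Metric.closedBall y r) := by
      rw [← measure_preimage_add_right volume e (Metric.closedBall (y + e) r)]
      congr 1; ext x; simp
    rw [← measure_preimage_add_right volume e, hpre, hv] at h2
    rw [ENNReal.lt_div_iff_mul_lt (Or.inl hpos) (Or.inl (measure_ne_top _ _))] at h1 h2
    have hBe : MeasurableSet ((fun x => x + e) ⁻¹' B) := measurable_add_const e hB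
    have hnull : volume ((B ∩ Metric.closedBall y r) ∩
        ((fun x => x + e) ⁻¹' B ∩ Metric.closedBall y r)) = 0 :=
      measure_mono_null (Set.inter_subset_inter Set.inter_subset_left Set.inter_subset_left) (h θ)
    have hun := measure_union_add_inter (μ := volume) (B ∩ Metric.closedBall y r)
      (hBe.inter (Metric.isClosed_closedBall (x := y) (ε := r)).measurableSet)
    rw [hnull, add_zero] at hun
    have hle : volume ((B ∩ Metric.closedBall y r) ∪
        ((fun x => x + e) ⁻¹' B ∩ Metric.closedBall y r)) ≤ volume (Metric.closedBall y r) :=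
      measure_mono (Set.union_subset Set.inter_subset_right Set.inter_subset_right)
    have := ENNReal.add_lt_add h1 h2
    rw [← hun, ← add_mul, ENNReal.add_halves, one_mul] at this
    exact this.not_ge hle
  rcases lt_or_ge (volume.real B - η) 0 with h0 | h0
  · exact ⟨∅, isCompact_empty, by simpa using h0, by simp⟩
  · have hlt : ENNReal.ofReal (volume.real B - η) < volume (B \ Z) := by
      rw [hBZ, ENNReal.ofReal_lt_iff_lt_toReal h0 (measure_ne_top _ _)]
      exact sub_lt_self _ hη
    obtain ⟨F, hF, hFc, hlt⟩ :=
      (hB.diff (measurableSet_toMeasurable _ _)).exists_lt_isCompact hlt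
    exact ⟨F, hFc, (ENNReal.ofReal_lt_iff_lt_toReal h0 (measure_ne_top _ _)).1 hlt, key F hF⟩

lemma exists_thickening_avoiding {K : ℝ} {F : Set Torus} (hF : IsCompact F)
    (h : ∀ θ, ∀ y ∈ F, y + shift K (Real.cos θ) (Real.sin θ) ∉ F) :
    ∃ ρ > 0, ∀ θ, ∀ y' z' : Torus, ∀ y ∈ F, ∀ z ∈ F, dist y' y ≤ ρ → dist z' z ≤ ρ →
      y' + shift K (Real.cos θ) (Real.sin θ) ≠ z' := by
  set g : ℝ × Torus × Torus → ℝ := fun p =>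
    dist (p.2.1 + shift K (Real.cos p.1) (Real.sin p.1)) p.2.2 with hg
  have hgc : Continuous g := by
    have := continuous_shift K (Real.continuous_cos.comp (continuous_fst (X := ℝ)
      (Y := Torus × Torus))) (Real.continuous_sin.comp continuous_fst)
    exact (continuous_snd.fst.add this).dist continuous_snd.snd
  obtain ⟨c, hc, hcg⟩ : ∃ c > 0, ∀ p ∈ Set.Icc 0 (2 * Real.pi) ×ˢ F ×ˢ F, c ≤ g p := by
    rcases (Set.Icc 0 (2 * Real.pi) ×ˢ F ×ˢ F).eq_empty_or_nonempty with he | hne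
    · exact ⟨1, one_pos, by simp [he]⟩
    · obtain ⟨p, hp, hmin⟩ := (isCompact_Icc.prod (hF.prod hF)).exists_isMinOn hne hgc.continuousOn
      refine ⟨g p, dist_pos.2 fun heq => ?_, fun q hq => hmin hq⟩
      exact h p.1 p.2.1 hp.2.1 (heq ▸ hp.2.2)
  refine ⟨c / 3, by positivity, fun θ y' z' y hy z hz hyy hzz heq => ?_⟩
  obtain ⟨t, ht, htθ⟩ := (shift_periodic K).exists_mem_Ico Real.two_pi_pos θ 0
  rw [zero_add] at ht
  have := hcg (t, y, z) ⟨⟨ht.1, ht.2.le⟩, hy, hz⟩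
  simp only [hg] at this htθ
  rw [← htθ] at this
  have h1 := dist_triangle (y + shift K (Real.cos θ) (Real.sin θ))
    (y' + shift K (Real.cos θ) (Real.sin θ)) z
  rw [dist_add_right, heq, dist_comm y y'] at h1
  linarith

open Classical in
lemma exists_two_rpow_le_card {K m : ℝ}
    (hm : IsLUB {t | ∃ B, MeasurableSet B ∧ Avoiding K B ∧ volume.real B = t} m)
    {η : ℝ} (hη : 0 < η) : ∃ ρ > 0, ∀ (ι : Type) [Fintype ι] (Q : ι → Set Torus), IsCells Q →
      (⋃ v, Q v) = Set.univ → (∀ v, ∀ x ∈ Q v, ∀ y ∈ Q v, dist x y ≤ ρ) →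
      Real.exp (Fintype.card ι * ((m - η) * Real.log 2)) ≤
        ((Finset.univ.filter fun S : Finset ι =>
          rotCorr K (ind (⋃ v ∈ S, Q v)) 1 0 = 0).card : ℝ) := by
  obtain ⟨_, ⟨B, hB, hBa, rfl⟩, hlt, -⟩ := hm.exists_between (b := m - η / 2) (by linarith)
  obtain ⟨F, hF, hFm, hFa⟩ := exists_isCompact_avoiding hB hBa (half_pos hη)
  obtain ⟨ρ, hρ, hthick⟩ := exists_thickening_avoiding hF hFa
  refine ⟨ρ, hρ, fun ι _ Q hQ hcov hdiam => ?_⟩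
  have hn := hQ.card_pos
  set S₀ : Finset ι := Finset.univ.filter fun v => (Q v ∩ F).Nonempty with hS₀
  have hcard : Fintype.card ι * (m - η) ≤ S₀.card := by
    have hsub : F ⊆ ⋃ v ∈ S₀, Q v := fun x hx => by
      obtain ⟨v, hv⟩ := Set.mem_iUnion.1 (hcov.symm ▸ Set.mem_univ x)
      exact Set.mem_biUnion (Finset.mem_filter.2 ⟨Finset.mem_univ v, x, hv, hx⟩) hv
    have := (measureReal_mono hsub (measure_ne_top volume _)).trans
      (measureReal_biUnion_finset_le S₀ Q)
    simp only [hQ.measure_eq, Finset.sum_const, nsmul_eq_mul] at this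
    rw [mul_one_div, le_div_iff₀ hn] at this
    nlinarith
  calc _ ≤ (2 : ℝ) ^ S₀.card := by
        rw [← Real.rpow_natCast, Real.rpow_def_of_pos two_pos, Real.exp_le_exp]
        have := Real.log_pos one_lt_two
        nlinarith
    _ = (S₀.powerset.card : ℝ) := by simp
    _ ≤ _ := by
        norm_cast
        refine Finset.card_le_card fun S hS => Finset.mem_filter.2 ⟨Finset.mem_univ _, ?_⟩
        refine Avoiding.rotCorr_eq_zero (hQ.measurableSet_biUnion S) fun θ => ?_
        suffices hemp : (⋃ v ∈ S, Q v) ∩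
            (fun y => y + shift K (Real.cos θ) (Real.sin θ)) ⁻¹' (⋃ v ∈ S, Q v) = ∅ by
          rw [hemp, measure_empty]
        refine Set.eq_empty_of_forall_notMem fun y hy => ?_
        obtain ⟨v, hv, hyv⟩ := Set.mem_iUnion₂.1 hy.1
        obtain ⟨u, hu, hyu⟩ := Set.mem_iUnion₂.1 hy.2
        obtain ⟨x, hx, hxF⟩ := (Finset.mem_filter.1 (Finset.mem_powerset.1 hS hv)).2
        obtain ⟨x', hx', hxF'⟩ := (Finset.mem_filter.1 (Finset.mem_powerset.1 hS hu)).2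
        exact hthick θ y _ x hxF x' hxF' (hdiam v _ hyv _ hx) (hdiam u _ hyu _ hx') rfl

/-- The representative in the unit square of a point of the torus. -/
noncomputable def torusRep (y : Torus) : EuclideanSpace ℝ (Fin 2) :=
  WithLp.toLp 2 fun i => ((AddCircle.equivIoc (1 : ℝ) 0 (y i) : Set.Ioc (0 : ℝ) (0 + 1)) : ℝ)

lemma measurable_torusRep : Measurable torusRep := by
  refine (PiLp.volume_preserving_toLp (Fin 2)).measurable.comp (measurable_pi_lambda _ fun i => ?_)
  exact measurable_subtype_coe.comp
    ((AddCircle.measurableEquivIoc (1 : ℝ) 0).measurable.comp (measurable_pi_apply i))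

lemma coe_torusRep (y : Torus) (i : Fin 2) : ((torusRep y i : ℝ) : UnitAddCircle) = y i :=
  AddCircle.coe_equivIoc (p := (1 : ℝ)) (a := 0)

lemma measurePreserving_torusMk : MeasurePreserving
    (fun (x : Fin 2 → ℝ) (i : Fin 2) => (x i : UnitAddCircle))
    (volume.restrict (Set.univ.pi fun _ => Set.Ioc (0 : ℝ) 1)) (volume : Measure Torus) := by
  rw [volume_pi, Measure.restrict_pi_pi]
  refine measurePreserving_pi _ _ fun i => ?_
  simpa using UnitAddCircle.measurePreserving_mk 0

lemma UnitAddCircle.eq_of_abs_sub_lt_one {a b : ℝ} (h : (a : UnitAddCircle) = b)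
    (hab : |a - b| < 1) : a = b := by
  have : ((a - b : ℝ) : UnitAddCircle) = 0 := by rw [AddCircle.coe_sub, h, sub_self]
  obtain ⟨n, hn⟩ := (AddCircle.coe_eq_zero_iff (p := (1 : ℝ))).1 this
  rw [zsmul_one] at hn
  rw [← hn] at hab
  have : n = 0 := Int.abs_lt_one_iff.1 (by exact_mod_cast hab)
  rw [this, Int.cast_zero] at hn
  linarith

lemma volume_torusRep_preimage {U : Set (EuclideanSpace ℝ (Fin 2))} (hU : MeasurableSet U)
    (h : ∀ x ∈ U, ∀ i, x i ∈ Set.Ioc (0 : ℝ) 1) : volume (torusRep ⁻¹' U) = volume U := by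
  rw [← measurePreserving_torusMk.measure_preimage (measurable_torusRep hU).nullMeasurableSet,
    Measure.restrict_apply (measurePreserving_torusMk.measurable (measurable_torusRep hU)),
    ← (PiLp.volume_preserving_toLp (Fin 2)).measure_preimage hU.nullMeasurableSet]
  congr 1
  have hrep : ∀ x : Fin 2 → ℝ, x ∈ Set.univ.pi (fun _ => Set.Ioc (0 : ℝ) 1) →
      torusRep (fun i => (x i : UnitAddCircle)) = WithLp.toLp 2 x := by
    intro x hx
    unfold torusRep
    congr 1
    funext i
    exact AddCircle.equivIoc_coe_of_mem (p := (1 : ℝ)) (a := 0) (by simpa using hx i (Set.mem_univ i))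
  ext x
  constructor
  · rintro ⟨h1, h2⟩
    rw [Set.mem_preimage, Set.mem_preimage, hrep x h2] at h1
    exact h1
  · intro hx
    have h2 : x ∈ Set.univ.pi (fun _ => Set.Ioc (0 : ℝ) 1) := fun i _ => h _ hx i
    exact ⟨by rw [Set.mem_preimage, Set.mem_preimage, hrep x h2]; exact hx, h2⟩

lemma abs_apply_le_norm_euclidean (x : EuclideanSpace ℝ (Fin 2)) (i : Fin 2) : |x i| ≤ ‖x‖ := by
  simpa using PiLp.norm_apply_le x i

/-- Discs of radius `1/2` whose centres are two apart give an avoiding set. -/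
lemma exists_avoiding_of_centers {K : ℝ} (hK : 0 < K) {ι : Type*} (s : Finset ι)
    (c : ι → EuclideanSpace ℝ (Fin 2))
    (hc : ∀ i ∈ s, ∀ k, c i k ∈ Set.Icc (1 / 2) (K - 5 / 2))
    (hs : (s : Set ι).Pairwise fun i j => 2 ≤ dist (c i) (c j)) :
    ∃ B, MeasurableSet B ∧ Avoiding K B ∧ volume.real B = s.card * (Real.pi / (4 * K ^ 2)) := by
  set U : Set (EuclideanSpace ℝ (Fin 2)) := ⋃ i ∈ s, Metric.ball (c i) (1 / 2) with hU
  have hUm : MeasurableSet U := s.measurableSet_biUnion fun i _ => measurableSet_ball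
  have hVm : MeasurableSet ((fun x => K • x) ⁻¹' U) := measurable_const_smul K hUm
  have hUbd : ∀ x ∈ U, ∀ k, 0 < x k ∧ x k < K - 2 := by
    intro x hx k
    obtain ⟨i, hi, hxi⟩ := Set.mem_iUnion₂.1 hx
    have h1 := abs_apply_le_norm_euclidean (x - c i) k
    rw [← dist_eq_norm] at h1
    have h2 := abs_lt.1 (h1.trans_lt (Metric.mem_ball.1 hxi))
    have h3 := hc i hi k
    simp only [PiLp.sub_apply] at h2
    constructor <;> linarith [h2.1, h2.2, h3.1, h3.2]
  refine ⟨torusRep ⁻¹' ((fun x => K • x) ⁻¹' U), measurable_torusRep hVm, fun θ => ?_, ?_⟩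
  · suffices hemp : torusRep ⁻¹' ((fun x => K • x) ⁻¹' U) ∩
        (fun y => y + shift K (Real.cos θ) (Real.sin θ)) ⁻¹'
          (torusRep ⁻¹' ((fun x => K • x) ⁻¹' U)) = ∅ by rw [hemp, measure_empty]
    refine Set.eq_empty_of_forall_notMem fun y ⟨hy, hy'⟩ => ?_
    simp only [Set.mem_preimage] at hy hy'
    set a := torusRep y with ha
    set b := torusRep (y + shift K (Real.cos θ) (Real.sin θ)) with hb
    set e : EuclideanSpace ℝ (Fin 2) := !₂[Real.cos θ, Real.sin θ] with he
    have hcoord : ∀ k, K * b k = K * a k + e k := by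
      intro k
      have hbk : ((b k : ℝ) : UnitAddCircle) = ((a k + e k / K : ℝ) : UnitAddCircle) := by
        rw [hb, coe_torusRep, AddCircle.coe_add, ha, coe_torusRep]
        fin_cases k <;> simp [shift, he]
      have h1 := hUbd _ hy k
      have h2 := hUbd _ hy' k
      simp only [PiLp.smul_apply, smul_eq_mul] at h1 h2
      have hek : |e k| ≤ 1 := by
        fin_cases k <;> simp [he, Real.abs_cos_le_one, Real.abs_sin_le_one]
      have hek' := abs_le.1 hek
      have := UnitAddCircle.eq_of_abs_sub_lt_one hbk (by
        have : b k - (a k + e k / K) = (K * b k - K * a k - e k) / K := by field_simp; ring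
        rw [this, abs_div, abs_of_pos hK, div_lt_one hK, abs_lt]
        constructor <;> linarith [h1.1, h1.2, h2.1, h2.2, hek'.1, hek'.2])
      rw [this]; field_simp
    have hdist : dist (K • a) (K • b) = 1 := by
      have : K • b - K • a = e := by
        ext k
        simp only [PiLp.sub_apply, PiLp.smul_apply, smul_eq_mul, hcoord k]
        ring
      rw [dist_comm, dist_eq_norm, this, EuclideanSpace.norm_eq]
      simp [he]
    obtain ⟨i, hi, hai⟩ := Set.mem_iUnion₂.1 hy
    obtain ⟨j, hj, hbj⟩ := Set.mem_iUnion₂.1 hy'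
    rw [Metric.mem_ball] at hai hbj
    by_cases hij : i = j
    · subst hij
      linarith [dist_triangle_right (K • a) (K • b) (c i)]
    · have h1 := hs hi hj hij
      have h2 := dist_triangle4 (c i) (K • a) (K • b) (c j)
      rw [dist_comm (c i) (K • a)] at h2
      linarith [h1.trans h2]
  · have hin : ∀ x ∈ (fun x : EuclideanSpace ℝ (Fin 2) => K • x) ⁻¹' U,
        ∀ i, x i ∈ Set.Ioc (0 : ℝ) 1 := fun x hx i => by
      have := hUbd _ hx i
      simp only [PiLp.smul_apply, smul_eq_mul] at this
      exact ⟨pos_of_mul_pos_right this.1 hK.le, by nlinarith [this.2]⟩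
    rw [Measure.real, volume_torusRep_preimage hVm hin, Measure.addHaar_preimage_smul _ hK.ne',
      hU, measure_biUnion_finset (fun i hi j hj hij => ?_) fun i _ => measurableSet_ball]
    · simp only [EuclideanSpace.volume_ball_fin_two, Finset.sum_const, nsmul_eq_mul,
        ENNReal.toReal_mul, ENNReal.toReal_natCast, ENNReal.toReal_pow, finrank_euclideanSpace,
        Fintype.card_fin]
      rw [ENNReal.toReal_ofReal (abs_nonneg _), ENNReal.toReal_ofReal (by norm_num),
        ENNReal.toReal_ofReal Real.pi_pos.le, abs_of_pos (by positivity)]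
      field_simp
      norm_num
    · exact Metric.ball_disjoint_ball (by linarith [hs hi hj hij])

/-- The points of the triangular lattice used as centres. -/
noncomputable def triPoint (p : ℕ × ℕ) : EuclideanSpace ℝ (Fin 2) :=
  !₂[1 / 2 + 2 * p.1 + (p.2 % 2 : ℕ), 1 / 2 + √3 * p.2]

lemma two_le_dist_triPoint {p q : ℕ × ℕ} (h : p ≠ q) : 2 ≤ dist (triPoint p) (triPoint q) := by
  obtain ⟨i, j⟩ := p
  obtain ⟨i', j'⟩ := q
  have h3 : √3 ^ 2 = (3 : ℝ) := Real.sq_sqrt (by norm_num)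
  set a : ℤ := 2 * (i - i') + (((j % 2 : ℕ) : ℤ) - ((j' % 2 : ℕ) : ℤ)) with ha
  set b : ℤ := j - j' with hb
  have hint : 4 ≤ a ^ 2 + 3 * b ^ 2 := by
    have hab : ∃ t, a = b + 2 * t := ⟨(a - b) / 2, by omega⟩
    have hne : a ≠ 0 ∨ b ≠ 0 := by
      by_contra! hcon
      apply h
      have : j = j' := by omega
      subst this
      have : i = i' := by omega
      rw [this]
    obtain ⟨t, ht⟩ := hab
    by_cases hb0 : b = 0
    · have ht0 : t ≠ 0 := by rintro ht'; subst ht'; omega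
      have : 1 ≤ t ^ 2 := Int.add_one_le_iff.2 (sq_pos_iff.2 ht0)
      rw [ht, hb0]; nlinarith
    · have hb1 : 1 ≤ b ^ 2 := Int.add_one_le_iff.2 (sq_pos_iff.2 hb0)
      by_cases ha0 : a = 0
      · have ht0 : t ≠ 0 := by rintro ht'; subst ht'; omega
        have : 1 ≤ t ^ 2 := Int.add_one_le_iff.2 (sq_pos_iff.2 ht0)
        have : b = -2 * t := by omega
        rw [this]; nlinarith
      · have : 1 ≤ a ^ 2 := Int.add_one_le_iff.2 (sq_pos_iff.2 ha0)
        linarith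
  rw [EuclideanSpace.dist_eq]
  refine Real.le_sqrt_of_sq_le ?_
  have hcast : (4 : ℝ) ≤ (a : ℝ) ^ 2 + 3 * (b : ℝ) ^ 2 := by exact_mod_cast hint
  simp only [Fin.sum_univ_two, triPoint, Real.dist_eq, sq_abs]
  have e1 : (1 / 2 + 2 * (i : ℝ) + (j % 2 : ℕ)) - (1 / 2 + 2 * (i' : ℝ) + (j' % 2 : ℕ)) = (a : ℝ) := by
    rw [ha]; simp only [Int.cast_add, Int.cast_mul, Int.cast_sub, Int.cast_natCast,
      Int.cast_ofNat]; ring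
  have e2 : (1 / 2 + √3 * (j : ℝ)) - (1 / 2 + √3 * (j' : ℝ)) = √3 * (b : ℝ) := by
    rw [hb]; push_cast; ring
  simp only [Matrix.cons_val_zero, Matrix.cons_val_one, Matrix.cons_val_fin_one]
  rw [e1, e2, mul_pow, h3]
  linarith

lemma exists_dense_avoiding {K : ℝ} (hK : 10000 ≤ K) :
    ∃ B, MeasurableSet B ∧ Avoiding K B ∧ 0.226 ≤ volume.real B := by
  have hs0 : (1.732 : ℝ) < √3 := Real.lt_sqrt_of_sq_lt (by norm_num)
  have hs1 : √3 < (1.7321 : ℝ) := (Real.sqrt_lt' (by norm_num)).2 (by norm_num)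
  set P := ⌊(K - 3) / 2⌋₊ with hP
  set R := ⌊(K - 3) / √3⌋₊ with hR
  have hP1 : (P : ℝ) ≤ (K - 3) / 2 := Nat.floor_le (by linarith)
  have hP2 : (K - 3) / 2 - 1 ≤ P := (Nat.sub_one_lt_floor _).le
  have hR1 : (R : ℝ) ≤ (K - 3) / √3 := Nat.floor_le (by apply div_nonneg <;> linarith)
  have hR2 : (K - 3) / √3 - 1 ≤ R := (Nat.sub_one_lt_floor _).le
  rw [le_div_iff₀ (by linarith)] at hR1
  have hR2' : (K - 5) / 1.7321 ≤ R := by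
    refine le_trans ?_ hR2
    rw [le_sub_iff_add_le, le_div_iff₀ (by linarith)]
    have : 0 ≤ (K - 5) / 1.7321 := by apply div_nonneg <;> linarith
    have h' : ((K - 5) / 1.7321) * 1.7321 = K - 5 := by norm_num
    nlinarith
  obtain ⟨B, hB, hBa, hv⟩ := exists_avoiding_of_centers (by linarith : 0 < K)
    (Finset.range P ×ˢ Finset.range R) triPoint (fun p hp k => by
      rw [Finset.mem_product, Finset.mem_range, Finset.mem_range] at hp
      have hp1 : (p.1 : ℝ) + 1 ≤ P := by exact_mod_cast hp.1
      have hp2 : (p.2 : ℝ) + 1 ≤ R := by exact_mod_cast hp.2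
      have hmod : ((p.2 % 2 : ℕ) : ℝ) ≤ 1 := by
        exact_mod_cast Nat.le_of_lt_succ (Nat.mod_lt p.2 two_pos)
      have h0 : (0 : ℝ) ≤ √3 * p.2 := by positivity
      fin_cases k
      · simp only [triPoint, Fin.zero_eta, Matrix.cons_val_zero, Set.mem_Icc]
        constructor
        · have : (0 : ℝ) ≤ 2 * p.1 + (p.2 % 2 : ℕ) := by positivity
          linarith
        · linarith
      · simp only [triPoint, Fin.mk_one, Matrix.cons_val_one, Matrix.cons_val_fin_one, Set.mem_Icc]
        constructor
        · linarith
        · nlinarith) fun p _ q _ hpq => two_le_dist_triPoint hpq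
  refine ⟨B, hB, hBa, ?_⟩
  rw [hv, Finset.card_product, Finset.card_range, Finset.card_range, Nat.cast_mul]
  have hPR : (K - 5) / 2 * ((K - 5) / 1.7321) ≤ (P : ℝ) * R :=
    mul_le_mul (by linarith) hR2' (by apply div_nonneg <;> linarith) (by positivity)
  calc (0.226 : ℝ) ≤ ((K - 5) / 2 * ((K - 5) / 1.7321)) * (3.1415 / (4 * K ^ 2)) := by
        have hsq : 0.999 * K ^ 2 ≤ (K - 5) ^ 2 := by nlinarith
        have hexp : (K - 5) / 2 * ((K - 5) / 1.7321) * 3.1415 =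
            (K - 5) ^ 2 * (3.1415 / 3.4642) := by ring
        rw [mul_div_assoc', le_div_iff₀ (by positivity), hexp]
        nlinarith [sq_nonneg K]
    _ ≤ _ := by
        gcongr
        exact Real.pi_gt_d4.le

/-- Rescaling of the unit torus to the torus of side `K`. -/
noncomputable def torusScale (K : ℝ) [hK : Fact (0 < K)] (y : Torus) : AddCircle K × AddCircle K :=
  (AddCircle.homeomorphAddCircle 1 K one_ne_zero hK.out.ne' (y 0),
    AddCircle.homeomorphAddCircle 1 K one_ne_zero hK.out.ne' (y 1))

section Scale

variable {K : ℝ} [hK : Fact (0 < K)]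

lemma torusScale_mk (y : Torus) {a b : ℝ} (ha : y 0 = (a : UnitAddCircle))
    (hb : y 1 = (b : UnitAddCircle)) :
    torusScale K y = (((a * K : ℝ) : AddCircle K), ((b * K : ℝ) : AddCircle K)) := by
  rw [torusScale, ha, hb]
  refine Prod.ext ?_ ?_ <;>
  · refine (AddCircle.homeomorphAddCircle_apply_mk 1 K one_ne_zero hK.out.ne' _).trans ?_
    simp

lemma torusScale_shift (x y : ℝ) :
    torusScale K (shift K x y) = ((x : AddCircle K), (y : AddCircle K)) := by
  have h : ∀ t : ℝ, t / K * K = t := fun t => div_mul_cancel₀ t hK.out.ne'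
  rw [torusScale_mk (shift K x y) (a := x / K) (b := y / K) rfl rfl, h, h]

lemma torusScale_add (x y : Torus) : torusScale K (x + y) = torusScale K x + torusScale K y :=
  Prod.ext (map_add (AddCircle.equivAddCircle 1 K one_ne_zero hK.out.ne') (x 0) (y 0))
    (map_add (AddCircle.equivAddCircle 1 K one_ne_zero hK.out.ne') (x 1) (y 1))

lemma measurePreserving_scaleCircle : MeasurePreserving
    (AddCircle.homeomorphAddCircle 1 K one_ne_zero hK.out.ne') (volume : Measure UnitAddCircle)
    AddCircle.haarAddCircle := by
  set e := AddCircle.homeomorphAddCircle 1 K one_ne_zero hK.out.ne'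
  refine ⟨e.continuous.measurable, ?_⟩
  have : (Measure.map e (volume : Measure UnitAddCircle)).IsAddHaarMeasure :=
    AddEquiv.isAddHaarMeasure_map (volume : Measure UnitAddCircle)
      (AddCircle.equivAddCircle 1 K one_ne_zero hK.out.ne') e.continuous e.symm.continuous
  have : IsProbabilityMeasure (Measure.map e (volume : Measure UnitAddCircle)) :=
    Measure.isProbabilityMeasure_map e.continuous.aemeasurable
  exact Measure.isAddHaarMeasure_eq_of_isProbabilityMeasure _ _

lemma measurePreserving_torusScale : MeasurePreserving (torusScale K) (volume : Measure Torus)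
    (AddCircle.haarAddCircle.prod AddCircle.haarAddCircle) :=
  (measurePreserving_scaleCircle.prod measurePreserving_scaleCircle).comp
    (volume_preserving_finTwoArrow UnitAddCircle)

lemma density_eq {A : Set (AddCircle K × AddCircle K)} (hA : MeasurableSet A) :
    density K A = volume.real (torusScale K ⁻¹' A) := by
  have hv : torusVolume K = (ENNReal.ofReal K * ENNReal.ofReal K) •
      (AddCircle.haarAddCircle (T := K)).prod AddCircle.haarAddCircle := by
    rw [torusVolume, dif_pos hK.out, Measure.volume_eq_prod, AddCircle.volume_eq_smul_haarAddCircle,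
      Measure.prod_smul_left, Measure.prod_smul_right, smul_smul]
  have hK0 := hK.out
  rw [density, hv, Measure.smul_apply, smul_eq_mul, ENNReal.toReal_mul, ENNReal.toReal_mul,
    ENNReal.toReal_ofReal hK0.le, Measure.real,
    measurePreserving_torusScale.measure_preimage hA.nullMeasurableSet]
  field_simp

lemma paircorr_eq {A : Set (AddCircle K × AddCircle K)} (hA : MeasurableSet A) (r : ℝ) :
    paircorr K A r = rotCorr K (ind (torusScale K ⁻¹' A)) r 0 := by
  simp only [paircorr, rotCorr, zero_mul, sub_zero, add_zero]
  congr 1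
  refine intervalIntegral.integral_congr fun θ _ => ?_
  rw [corr_ind (measurePreserving_torusScale.measurable hA), autocorr,
    density_eq (hA.inter (measurable_add_const _ hA))]
  congr 1
  ext y
  simp only [Set.mem_preimage, Set.mem_inter_iff, torusScale_add, torusScale_shift]

lemma paircorr_eq_zero_of_density_eq_zero {A : Set (AddCircle K × AddCircle K)}
    (hA : MeasurableSet A) (h : density K A = 0) (r : ℝ) : paircorr K A r = 0 := by
  have h0 : ∀ x, autocorr K A x = 0 := fun x => by
    rw [density_eq hA] at h
    rw [autocorr, density_eq (hA.inter (measurable_add_const _ hA))]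
    exact le_antisymm ((measureReal_mono (Set.preimage_mono Set.inter_subset_left)
      (measure_ne_top volume _)).trans h.le) measureReal_nonneg
  simp [paircorr, h0]

end Scale

lemma isCells_of_iUnion_eq_univ {ι : Type*} [Fintype ι] [Nonempty ι] {Q : ι → Set Torus}
    (hm : ∀ v, MeasurableSet (Q v)) (hv : ∀ v, volume.real (Q v) = 1 / Fintype.card ι)
    (hcov : (⋃ v, Q v) = Set.univ) : IsCells Q := by
  classical
  refine ⟨hm, fun u v huv => ?_, hv, inferInstance⟩
  have hn : (0 : ℝ) < Fintype.card ι := by exact_mod_cast Fintype.card_pos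
  have huniv : (Set.univ : Set Torus) ⊆
      (Q u ∪ Q v) ∪ ⋃ w ∈ (Finset.univ.erase u).erase v, Q w := fun y _ => by
    obtain ⟨w, hw⟩ := Set.mem_iUnion.1 (hcov.symm ▸ Set.mem_univ y)
    by_cases h1 : w = u
    · exact Or.inl (Or.inl (h1 ▸ hw))
    by_cases h2 : w = v
    · exact Or.inl (Or.inr (h2 ▸ hw))
    · exact Or.inr (Set.mem_biUnion (by simp [h1, h2]) hw)
  have h1 := (measureReal_mono huniv (measure_ne_top volume _)).trans
    ((measureReal_union_le _ _).trans (add_le_add_right (measureReal_biUnion_finset_le _ _) _))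
  have h2 := measureReal_union_add_inter (μ := volume) (s := Q u) (hm v)
  have hcard : (((Finset.univ.erase u).erase v).card : ℝ) = Fintype.card ι - 2 := by
    have h3 := Finset.card_erase_of_mem (Finset.mem_univ u)
    have h4 := Finset.card_erase_of_mem (s := Finset.univ.erase u)
      (Finset.mem_erase.2 ⟨huv.symm, Finset.mem_univ v⟩)
    have h5 : 2 ≤ Fintype.card ι := Fintype.one_lt_card_iff.2 ⟨u, v, huv⟩
    rw [h4, h3, Finset.card_univ, Nat.sub_sub, Nat.cast_sub h5]
    norm_num
  simp only [hv, Finset.sum_const, nsmul_eq_mul, hcard, probReal_univ] at h1 h2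
  have h6 : ((Fintype.card ι : ℝ) - 2) * (1 / Fintype.card ι) = 1 - 2 * (1 / Fintype.card ι) := by
    field_simp
  have h7 : volume.real (Q u ∩ Q v) ≤ 0 := by linarith
  exact (measureReal_eq_zero_iff (measure_ne_top _ _)).1 (le_antisymm h7 measureReal_nonneg)

lemma IsCells.subset_of_biUnion_subset {ι : Type*} [Fintype ι] {Q : ι → Set Torus}
    (hQ : IsCells Q) {S T : Finset ι} (h : (⋃ v ∈ S, Q v) ⊆ ⋃ v ∈ T, Q v) : S ⊆ T := by
  intro v hv
  by_contra hvT
  have hnull : volume (Q v) = 0 := by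
    have hsub : Q v ⊆ ⋃ u ∈ T, Q v ∩ Q u := fun y hy => by
      obtain ⟨u, hu, hyu⟩ := Set.mem_iUnion₂.1 (h (Set.mem_biUnion hv hy))
      exact Set.mem_biUnion hu ⟨hy, hyu⟩
    refine measure_mono_null hsub ((measure_biUnion_null_iff T.countable_toSet).2 fun u hu => ?_)
    exact hQ.aedisjoint fun huv => hvT (huv ▸ hu)
  have h1 := hQ.measure_eq v
  have := hQ.card_pos
  rw [Measure.real, hnull, ENNReal.toReal_zero] at h1
  exact absurd h1.symm (by positivity)

/-- The centre of a cell of the grid of mesh `1/M` on the unit torus. -/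
noncomputable def cellCenter {M : ℕ} (v : Fin M × Fin M) : Torus :=
  ![(((v.1 + 1 / 2 : ℝ) / M : ℝ) : UnitAddCircle), (((v.2 + 1 / 2 : ℝ) / M : ℝ) : UnitAddCircle)]

/-- The cells of the grid of mesh `1/M` on the unit torus. -/
def gridCell {M : ℕ} (v : Fin M × Fin M) : Set Torus :=
  Metric.closedBall (cellCenter v) (1 / (2 * M))

lemma mem_gridCell {M : ℕ} {v : Fin M × Fin M} {y : Torus} : y ∈ gridCell v ↔
    dist (y 0) (((v.1 + 1 / 2 : ℝ) / M : ℝ) : UnitAddCircle) ≤ 1 / (2 * M) ∧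
    dist (y 1) (((v.2 + 1 / 2 : ℝ) / M : ℝ) : UnitAddCircle) ≤ 1 / (2 * M) := by
  rw [gridCell, Metric.mem_closedBall, dist_pi_le_iff (by positivity), Fin.forall_fin_two]
  rfl

lemma UnitAddCircle.dist_le_of_abs_sub_le {a b r : ℝ} (h : |a - b| ≤ r) :
    dist (a : UnitAddCircle) b ≤ r := by
  rw [dist_eq_norm, ← AddCircle.coe_sub]
  refine le_trans ?_ h
  rw [UnitAddCircle.norm_eq]
  simpa using round_le (a - b) 0

lemma isCells_gridCell {M : ℕ} (hM : 0 < M) :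
    IsCells (gridCell (M := M)) ∧ (⋃ v, gridCell (M := M) v) = Set.univ := by
  have hM' : (0 : ℝ) < M := by exact_mod_cast hM
  have : Nonempty (Fin M) := ⟨⟨0, hM⟩⟩
  have hcirc : ∀ x : UnitAddCircle, ∃ j : Fin M,
      dist x (((j + 1 / 2 : ℝ) / M : ℝ) : UnitAddCircle) ≤ 1 / (2 * M) := fun x => by
    obtain ⟨s, ⟨hs0, hs1⟩, rfl⟩ := AddCircle.eq_coe_Ico x
    have hfl : ⌊s * M⌋₊ < M := (Nat.floor_lt (by positivity)).2 (by nlinarith)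
    refine ⟨⟨_, hfl⟩, UnitAddCircle.dist_le_of_abs_sub_le ?_⟩
    have h1 := Nat.floor_le (by positivity : 0 ≤ s * M)
    have h2 := Nat.lt_floor_add_one (s * M)
    have : s - ((⌊s * M⌋₊ : ℝ) + 1 / 2) / M = (s * M - ⌊s * M⌋₊ - 1 / 2) / M := by
      field_simp; ring
    simp only
    rw [this, abs_div, abs_of_pos hM', div_le_iff₀ hM',
      show 1 / (2 * (M : ℝ)) * M = 1 / 2 by field_simp, abs_le]
    constructor <;> linarith
  have hcov : (⋃ v, gridCell (M := M) v) = Set.univ := Set.eq_univ_of_forall fun y => by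
    obtain ⟨j, hj⟩ := hcirc (y 0)
    obtain ⟨k, hk⟩ := hcirc (y 1)
    exact Set.mem_iUnion.2 ⟨(j, k), mem_gridCell.2 ⟨hj, hk⟩⟩
  refine ⟨isCells_of_iUnion_eq_univ (fun v => Metric.isClosed_closedBall.measurableSet)
    (fun v => ?_) hcov, hcov⟩
  have hM1 : 2 * (1 / (2 * (M : ℝ))) ≤ 1 := by
    rw [show 2 * (1 / (2 * (M : ℝ))) = 1 / M by field_simp, div_le_one hM']
    exact_mod_cast hM
  rw [gridCell, closedBall_pi _ (by positivity), Measure.real, volume_pi_pi, Fin.prod_univ_two,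
    AddCircle.volume_closedBall, AddCircle.volume_closedBall, min_eq_right hM1,
    ENNReal.toReal_mul, ENNReal.toReal_ofReal (by positivity), Fintype.card_prod, Fintype.card_fin]
  push_cast
  field_simp

lemma dist_le_of_mem_gridCell {M : ℕ} (v : Fin M × Fin M) {x y : Torus} (hx : x ∈ gridCell v)
    (hy : y ∈ gridCell v) : dist x y ≤ 1 / M := by
  refine (dist_triangle_right x y (cellCenter v)).trans ((add_le_add hx hy).trans_eq ?_)
  rw [one_div, one_div, mul_inv]; ring

lemma exists_lift_mem_Icc_iff {K N : ℝ} (hK : 0 < K) (hN : 0 < N) (s j : ℝ) :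
    (∃ p : ℝ, ((s * K : ℝ) : AddCircle K) = p ∧ j / N ≤ p ∧ p ≤ (j + 1) / N) ↔
      dist (s : UnitAddCircle) (((j + 1 / 2) / (N * K) : ℝ) : UnitAddCircle) ≤
        1 / (2 * (N * K)) := by
  have key : ∀ t : ℝ, |t - (j + 1 / 2) / (N * K)| ≤ 1 / (2 * (N * K)) ↔
      j / N ≤ t * K ∧ t * K ≤ (j + 1) / N := fun t => by
    have h1 : t - (j + 1 / 2) / (N * K) = (t * K * N - j - 1 / 2) / (N * K) := by
      field_simp; ring
    rw [h1, abs_div, abs_of_pos (mul_pos hN hK), div_le_iff₀ (mul_pos hN hK),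
      show 1 / (2 * (N * K)) * (N * K) = 1 / 2 by field_simp, abs_le, div_le_iff₀ hN,
      le_div_iff₀ hN]
    constructor <;> rintro ⟨h, h'⟩ <;> constructor <;> linarith
  constructor
  · rintro ⟨p, hp, h1, h2⟩
    have h0 : ((s * K - p : ℝ) : AddCircle K) = 0 := by rw [AddCircle.coe_sub, hp, sub_self]
    obtain ⟨n, hn⟩ := (AddCircle.coe_eq_zero_iff K).1 h0
    rw [zsmul_eq_mul] at hn
    have hpn : p = (s - n) * K := by linarith
    have hs : (s : UnitAddCircle) = ((s - n : ℝ) : UnitAddCircle) := by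
      have : ((n : ℝ) : UnitAddCircle) = 0 :=
        (AddCircle.coe_eq_zero_iff (p := (1 : ℝ))).2 ⟨n, by simp⟩
      rw [AddCircle.coe_sub, this, sub_zero]
    rw [hs]
    exact UnitAddCircle.dist_le_of_abs_sub_le ((key _).2 (hpn ▸ ⟨h1, h2⟩))
  · intro h
    rw [dist_eq_norm, ← AddCircle.coe_sub, UnitAddCircle.norm_eq] at h
    set n := round (s - (j + 1 / 2) / (N * K))
    refine ⟨(s - n) * K, ?_, (key (s - n)).1 (by convert h using 2; ring)⟩
    have : ((s * K - (s - n) * K : ℝ) : AddCircle K) = 0 :=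
      (AddCircle.coe_eq_zero_iff K).2 ⟨n, by rw [zsmul_eq_mul]; ring⟩
    rwa [AddCircle.coe_sub, sub_eq_zero] at this

lemma torusScale_preimage_gridSquare {K N : ℕ} [hK : Fact (0 < (K : ℝ))] (hN : 0 < N)
    (v : Fin (N * K) × Fin (N * K)) :
    torusScale (K : ℝ) ⁻¹' gridSquare K N v = gridCell v := by
  have hN' : (0 : ℝ) < N := by exact_mod_cast hN
  ext y
  obtain ⟨s, -, hs⟩ := AddCircle.eq_coe_Ico (y 0)
  obtain ⟨t, -, ht⟩ := AddCircle.eq_coe_Ico (y 1)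
  rw [mem_gridCell, ← hs, ← ht, Set.mem_preimage, torusScale_mk y hs.symm ht.symm, Nat.cast_mul,
    ← exists_lift_mem_Icc_iff hK.out hN', ← exists_lift_mem_Icc_iff hK.out hN']
  simp only [gridSquare, Set.mem_ofPred_eq, Prod.mk.injEq]
  constructor
  · rintro ⟨p, ⟨h1, h2⟩, h3, h4, h5, h6⟩
    exact ⟨⟨p.1, h1, h3, h4⟩, ⟨p.2, h2, h5, h6⟩⟩
  · rintro ⟨⟨p, h1, h3, h4⟩, ⟨q, h2, h5, h6⟩⟩
    exact ⟨(p, q), ⟨h1, h2⟩, h3, h4, h5, h6⟩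

lemma measurableSet_gridSquare (K N : ℕ) (v : Fin (N * K) × Fin (N * K)) :
    MeasurableSet (gridSquare K N v) := by
  have himage : gridSquare K N v = (fun p : ℝ × ℝ => ((p.1 : AddCircle (K : ℝ)),
      (p.2 : AddCircle (K : ℝ)))) '' (Set.Icc ((v.1 : ℝ) / N) (((v.1 : ℝ) + 1) / N) ×ˢ
        Set.Icc ((v.2 : ℝ) / N) (((v.2 : ℝ) + 1) / N)) := by
    ext q
    constructor
    · rintro ⟨p, rfl, h1, h2, h3, h4⟩
      exact ⟨p, ⟨⟨h1, h2⟩, ⟨h3, h4⟩⟩, rfl⟩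
    · rintro ⟨p, ⟨⟨h1, h2⟩, ⟨h3, h4⟩⟩, rfl⟩
      exact ⟨p, rfl, h1, h2, h3, h4⟩
  rw [himage]
  refine ((isCompact_Icc.prod isCompact_Icc).image ?_).isClosed.measurableSet
  exact ((AddCircle.continuous_mk' _).comp continuous_fst).prodMk
    ((AddCircle.continuous_mk' _).comp continuous_snd)

open Classical in
/-- Avoiding unions of fine cells are typically clustered. -/
lemma exists_card_badSets_le {K : ℝ} (hK : 10000 ≤ K) {ε : ℝ} (hε : 0 < ε) :
    ∃ ρ n₀ : ℝ, 0 < ρ ∧ ∀ (ι : Type) [Fintype ι] (Q : ι → Set Torus), IsCells Q →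
      (⋃ v, Q v) = Set.univ → (∀ v, ∀ x ∈ Q v, ∀ y ∈ Q v, dist x y ≤ ρ) →
      n₀ ≤ Fintype.card ι → ((badSets K Q).card : ℝ) ≤
        ε * ((Finset.univ.filter fun S : Finset ι =>
          rotCorr K (ind (⋃ v ∈ S, Q v)) 1 0 = 0).card : ℝ) := by
  obtain ⟨B₀, hB₀, hB₀a, hB₀v⟩ := exists_dense_avoiding hK
  set X := {t | ∃ B, MeasurableSet B ∧ Avoiding K B ∧ volume.real B = t} with hX
  have hbdd : BddAbove X := ⟨1, by rintro _ ⟨B, -, -, rfl⟩; exact measureReal_le_one⟩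
  have hlub : IsLUB X (sSup X) := isLUB_csSup ⟨_, B₀, hB₀, hB₀a, rfl⟩ hbdd
  set m := sSup X
  have hm : ∀ B, MeasurableSet B → Avoiding K B → volume.real B ≤ m :=
    fun B hB hBa => hlub.1 ⟨B, hB, hBa, rfl⟩
  have hm0 : 0.226 ≤ m := hB₀v.trans (hm _ hB₀ hB₀a)
  obtain ⟨C, η, hη, hbad⟩ := card_badSets_le (by linarith) hm fun B hB hBa hBm => by
    have := hBa.lt_rotCorr (by linarith) hB (hBm ▸ hm0)
    rw [hBm] at this
    nlinarith [sq_nonneg m]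
  have hlog := Real.log_pos one_lt_two
  obtain ⟨ρ, hρ, hcount⟩ := exists_two_rpow_le_card hlub
    (by positivity : 0 < η / 2 / Real.log 2)
  refine ⟨ρ, C / ε * (2 / η), hρ, fun ι _ Q hQ hcov hdiam hn => (hbad ι Q hQ).trans ?_⟩
  refine le_trans ?_ (mul_le_mul_of_nonneg_left (hcount ι Q hQ hcov hdiam) hε.le)
  have hsplit : Fintype.card ι * ((m - η / 2 / Real.log 2) * Real.log 2) =
      Fintype.card ι * (η / 2) + Fintype.card ι * (m * Real.log 2 - η) := by
    field_simp; ring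
  rw [hsplit, Real.exp_add, ← mul_assoc]
  refine mul_le_mul_of_nonneg_right ?_ (Real.exp_pos _).le
  rw [← div_le_iff₀' hε]
  have h1 := Real.add_one_le_exp (Fintype.card ι * (η / 2))
  have h2 : C / ε = C / ε * (2 / η) * (η / 2) := by field_simp
  have h3 := mul_le_mul_of_nonneg_right hn (half_pos hη).le
  linarith

/-- There exist `γ > 0` and `K₀ > 0` such that for every integer `K > K₀` and every `ε > 0`
there is `N₀ = N₀(K, ε)` such that for every integer `N > N₀`: among the finitely many
1-avoiding subsets of `𝕋_K²` that are locally constant at scale `1/N`, the proportion of sets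
`A` with `s(1.96; A) ≥ 1 + γ` is at least `1 - ε`. -/
theorem typical_avoiding_sets_cluster :
    ∃ γ > (0:ℝ), ∃ K₀ : ℕ, 0 < K₀ ∧ ∀ K : ℕ, K₀ < K → ∀ ε > (0:ℝ), ∃ N₀ : ℕ, ∀ N : ℕ, N₀ < N →
      (1 - ε) * ({A : Set (AddCircle (K : ℝ) × AddCircle (K : ℝ)) |
            LocallyConst K N A ∧ paircorr (K : ℝ) A 1 = 0}.ncard : ℝ) ≤
        ({A : Set (AddCircle (K : ℝ) × AddCircle (K : ℝ)) |
            LocallyConst K N A ∧ paircorr (K : ℝ) A 1 = 0 ∧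
              1 + γ ≤ scorr (K : ℝ) A 1.96}.ncard : ℝ) := by
  classical
  refine ⟨0.001, by norm_num, 10000, by norm_num, fun K hK ε hε => ?_⟩
  have hK1 : (10000 : ℝ) ≤ K := by exact_mod_cast hK.le
  have hKpos : (0 : ℝ) < K := by linarith
  have : Fact (0 < (K : ℝ)) := ⟨hKpos⟩
  obtain ⟨ρ, n₀, hρ, hcount⟩ := exists_card_badSets_le hK1 hε
  refine ⟨max ⌈1 / ρ⌉₊ ⌈n₀⌉₊, fun N hN => ?_⟩
  have hN0 : 0 < N := (Nat.zero_le _).trans_lt hN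
  have hN1 : 1 / ρ ≤ N := (Nat.le_ceil _).trans (by exact_mod_cast (le_max_left _ _).trans hN.le)
  have hN2 : n₀ ≤ N := (Nat.le_ceil _).trans (by exact_mod_cast (le_max_right _ _).trans hN.le)
  have hM : 0 < N * K := Nat.mul_pos hN0 (by omega)
  have hNM : N ≤ N * K := Nat.le_mul_of_pos_right N (by omega)
  have hNM' : (N : ℝ) ≤ (N * K : ℕ) := by exact_mod_cast hNM
  obtain ⟨hQ, hcov⟩ := isCells_gridCell hM
  have hbad := hcount _ gridCell hQ hcov (fun v x hx y hy =>
    (dist_le_of_mem_gridCell v hx hy).trans (by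
      rw [one_div_le (by exact_mod_cast hM) hρ]
      exact hN1.trans hNM')) (by
    rw [Fintype.card_prod, Fintype.card_fin]
    refine hN2.trans (hNM'.trans ?_)
    exact_mod_cast Nat.le_mul_of_pos_right _ hM)
  set F : Finset (Fin (N * K) × Fin (N * K)) → Set (AddCircle (K : ℝ) × AddCircle (K : ℝ)) :=
    fun S => ⋃ v ∈ S, gridSquare K N v with hF
  have hFm : ∀ S, MeasurableSet (F S) := fun S =>
    S.measurableSet_biUnion fun v _ => measurableSet_gridSquare K N v
  have hpre : ∀ S, torusScale (K : ℝ) ⁻¹' F S = ⋃ v ∈ S, gridCell v := fun S => by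
    simp only [hF, Set.preimage_iUnion, torusScale_preimage_gridSquare hN0]
  have hinj : Function.Injective F := fun S T h => by
    have h' : (⋃ v ∈ S, gridCell v) = ⋃ v ∈ T, gridCell v := by rw [← hpre, ← hpre, h]
    exact (hQ.subset_of_biUnion_subset h'.le).antisymm (hQ.subset_of_biUnion_subset h'.ge)
  set G : Finset (Finset (Fin (N * K) × Fin (N * K))) := Finset.univ.filter fun S =>
    rotCorr K (ind (⋃ v ∈ S, gridCell v)) 1 0 = 0 with hG
  set bad := badSets (K : ℝ) (gridCell (M := N * K)) with hbad_def
  have hall : {A : Set (AddCircle (K : ℝ) × AddCircle (K : ℝ)) |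
      LocallyConst K N A ∧ paircorr (K : ℝ) A 1 = 0} = F '' G := by
    ext A
    constructor
    · rintro ⟨⟨S, rfl⟩, hA⟩
      have hS : (⋃ v ∈ S, gridSquare K N v) = F S.toFinset := by simp [hF]
      rw [hS, paircorr_eq (hFm _), hpre] at hA
      exact ⟨S.toFinset, by simpa [hG] using hA, hS.symm⟩
    · rintro ⟨S, hS, rfl⟩
      refine ⟨⟨S, by simp [hF]⟩, ?_⟩
      rw [paircorr_eq (hFm _), hpre]
      exact (Finset.mem_filter.1 hS).2
  have hgood : F '' G \ F '' bad ⊆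
      {A : Set (AddCircle (K : ℝ) × AddCircle (K : ℝ)) | LocallyConst K N A ∧
        paircorr (K : ℝ) A 1 = 0 ∧ 1 + 0.001 ≤ scorr (K : ℝ) A 1.96} := by
    rintro A ⟨hA, hAbad⟩
    obtain ⟨h1, h2⟩ := hall.ge hA
    refine ⟨h1, h2, ?_⟩
    obtain ⟨S, hS, rfl⟩ := hA
    by_contra! hlt
    refine hAbad ⟨S, Finset.mem_filter.2 ⟨Finset.mem_univ _, (Finset.mem_filter.1 hS).2, ?_⟩, rfl⟩
    rw [← hpre, ← paircorr_eq (hFm S), ← density_eq (hFm S)]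
    by_cases hd : density (K : ℝ) (F S) = 0
    · rw [paircorr_eq_zero_of_density_eq_zero (hFm S) hd, hd]; norm_num
    · rw [scorr, div_lt_iff₀ (by positivity)] at hlt
      norm_num at hlt ⊢
      exact hlt.le
  have hfin : {A : Set (AddCircle (K : ℝ) × AddCircle (K : ℝ)) | LocallyConst K N A ∧
      paircorr (K : ℝ) A 1 = 0 ∧ 1 + 0.001 ≤ scorr (K : ℝ) A 1.96}.Finite :=
    (G.finite_toSet.image F).subset fun A hA => hall.le ⟨hA.1, hA.2.1⟩
  have hle := (Set.ncard_le_ncard_sdiff_add_ncard (F '' G) (F '' bad)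
    (bad.finite_toSet.image F)).trans
    (add_le_add_left (Set.ncard_le_ncard hgood hfin) _)
  rw [Set.InjOn.ncard_image hinj.injOn, Set.InjOn.ncard_image hinj.injOn, Set.ncard_coe_finset,
    Set.ncard_coe_finset] at hle
  rw [hall, Set.InjOn.ncard_image hinj.injOn, Set.ncard_coe_finset]
  have hle' : (G.card : ℝ) ≤ ({A : Set (AddCircle (K : ℝ) × AddCircle (K : ℝ)) |
      LocallyConst K N A ∧ paircorr (K : ℝ) A 1 = 0 ∧
        1 + 0.001 ≤ scorr (K : ℝ) A 1.96}.ncard : ℝ) + bad.card := by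
    exact_mod_cast hle
  linarith
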